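/- arXiv:1712.03180 — 2 statements merged into one kernel-verified Lean document; each statement's English description precedes it below -/
import Mathlib

section
/- If K is a polyhedron and 𝒦 = {K_i}_{i∈I} is an AE(n)-cover of K by subcomplexes, then the collection ost_{βK}𝒦 = {ost_{βK} K_i}_{i∈I} of open stars of these subcomplexes taken in the barycentric subdivision βK is an open AE(n)-cover of K; moreover, ost_{βK}𝒦 and 𝒦 are isomorphic covers of K. -/
open Set Metric unitInterval
open scoped ENNReal Classical

noncomputable section

/-! ### Basic extension-theoretic notions -/

/-- A topological space has covering dimension `< n` (order of refinements at most `n`):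
every open cover admits an open refinement in which every point belongs to
at most `n` members. -/
def CovDimLT (X : Type*) [TopologicalSpace X] (n : ℕ) : Prop :=
  ∀ U : Set (Set X), (∀ u ∈ U, IsOpen u) → ⋃₀ U = univ →
    ∃ R : Set (Set X), (∀ r ∈ R, IsOpen r) ∧ ⋃₀ R = univ ∧
      (∀ r ∈ R, ∃ u ∈ U, r ⊆ u) ∧
      ∀ x : X, {r ∈ R | x ∈ r}.Finite ∧ {r ∈ R | x ∈ r}.ncard ≤ n

/-- Lebesgue covering dimension at most `n`. -/
def CovDimLE (X : Type*) [TopologicalSpace X] (n : ℕ) : Prop :=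
  CovDimLT X (n + 1)

/-- `X` is an absolute extensor in dimension `n` (an `AE(n)`): every continuous map into `X`
from a closed subset of an at most `n`-dimensional metric space `Y` extends continuously
over all of `Y`. -/
def IsAE.{u, v} (n : ℕ) (X : Type v) [TopologicalSpace X] : Prop :=
  ∀ (Y : Type u) [MetricSpace Y], CovDimLE Y n →
    ∀ A : Set Y, IsClosed A → ∀ f : C(A, X),
      ∃ g : C(Y, X), ∀ a : A, g ↑a = f a

/-- `X` is an absolute neighborhood extensor in dimension `n` (an `ANE(n)`): every continuous
map into `X` from a closed subset `A` of an at most `n`-dimensional metric space extends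
continuously over some open neighborhood of `A`. -/
def IsANE.{u, v} (n : ℕ) (X : Type v) [TopologicalSpace X] : Prop :=
  ∀ (Y : Type u) [MetricSpace Y], CovDimLE Y n →
    ∀ A : Set Y, IsClosed A → ∀ f : C(A, X),
      ∃ (U : Set Y) (_ : IsOpen U) (hAU : A ⊆ U) (g : C(U, X)),
        ∀ (a : Y) (ha : a ∈ A), g ⟨a, hAU ha⟩ = f ⟨a, ha⟩

/-- `X` is an `ANE(∞)`: an absolute neighborhood extensor for the class of all metric
spaces (no dimension restriction). -/
def IsANEInf.{u, v} (X : Type v) [TopologicalSpace X] : Prop :=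
  ∀ (Y : Type u) [MetricSpace Y],
    ∀ A : Set Y, IsClosed A → ∀ f : C(A, X),
      ∃ (U : Set Y) (_ : IsOpen U) (hAU : A ⊆ U) (g : C(U, X)),
        ∀ (a : Y) (ha : a ∈ A), g ⟨a, hAU ha⟩ = f ⟨a, ha⟩

/-! ### Covers -/

/-- An (indexed) family is a cover when its union is everything. -/
def IsCover {ι X : Type*} (F : ι → Set X) : Prop :=
  (⋃ i, F i) = univ

/-- A cover is an `AE(n)`-cover if the intersection of every (nonempty) subfamily is either
empty or an absolute extensor in dimension `n`. -/
def IsAECover.{u, v, w} (n : ℕ) {ι : Type v} {X : Type w} [TopologicalSpace X]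
    (F : ι → Set X) : Prop :=
  IsCover F ∧ ∀ A : Set ι, A.Nonempty →
    (⋂ i ∈ A, F i) = ∅ ∨ IsAE.{u} n (⋂ i ∈ A, F i)

/-- Two covers with the same indexing set are isomorphic if corresponding subfamilies
have nonempty intersections simultaneously. -/
def CoversIsomorphic {ι X Y : Type*} (F : ι → Set X) (G : ι → Set Y) : Prop :=
  ∀ J : Set ι, (⋂ i ∈ J, F i).Nonempty ↔ (⋂ i ∈ J, G i).Nonempty

/-- A cover is locally finite-dimensional if its nerve is a locally finite-dimensional
simplicial complex: every vertex belongs to simplices of bounded dimension only. -/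
def LocallyFinDimCover {ι X : Type*} (F : ι → Set X) : Prop :=
  ∀ i : ι, ∃ N : ℕ, ∀ A : Finset ι, i ∈ A → (⋂ j ∈ A, F j).Nonempty → A.card ≤ N

/-- Two maps are `F`-close when each pair of corresponding values lies in a common
element of `F`. -/
def CoverClose {ι X Y : Type*} (F : ι → Set Y) (f g : X → Y) : Prop :=
  ∀ x : X, ∃ i : ι, f x ∈ F i ∧ g x ∈ F i

/-- Two maps are `F`-homotopic when they are joined by a homotopy each of whose paths
lies in a single element of `F`. -/
def CoverHomotopic {ι X Y : Type*} [TopologicalSpace X] [TopologicalSpace Y]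
    (F : ι → Set Y) (f g : C(X, Y)) : Prop :=
  ∃ H : f.Homotopy g, ∀ x : X, ∃ i : ι, ∀ t : unitInterval, H (t, x) ∈ F i

/-- The mesh of a cover: the supremum of the diameters of its elements. -/
def coverMesh {ι X : Type*} [PseudoEMetricSpace X] (F : ι → Set X) : ℝ≥0∞ :=
  ⨆ i, EMetric.diam (F i)

/-! ### Homotopy-theoretic notions -/

/-- The function induced by a continuous map on homotopy groups (of index type `N`). -/
def HomotopyGroup.inducedMap {X Y : Type*} [TopologicalSpace X] [TopologicalSpace Y]
    (f : C(X, Y)) (N : Type*) (x : X) :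
    HomotopyGroup N X x → HomotopyGroup N Y (f x) :=
  Quotient.map
    (fun g => ⟨f.comp g.1, fun y hy => by
      simp only [ContinuousMap.comp_apply]
      rw [g.2 y hy]⟩)
    (fun g h H => H.elim fun H => ⟨H.compContinuousMap f⟩)

/-- A continuous map is a weak `n`-homotopy equivalence if it induces isomorphisms on
homotopy groups in all dimensions `< n`, regardless of the choice of basepoint. -/
def IsWeakNHomotopyEquiv {X Y : Type*} [TopologicalSpace X] [TopologicalSpace Y]
    (n : ℕ) (f : C(X, Y)) : Prop :=
  ∀ k < n, ∀ x : X, Function.Bijective (HomotopyGroup.inducedMap f (Fin k) x)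

/-- `X` has vanishing homotopy groups in all dimensions `< n`, for every basepoint. -/
def VanishingHomotopyBelow (n : ℕ) (X : Type*) [TopologicalSpace X] : Prop :=
  ∀ k < n, ∀ x : X, Subsingleton (HomotopyGroup (Fin k) X x)

/-- `f` is null-homotopic inside the subset `U`: there is a homotopy, with values in `U`,
from `f` to a constant map. -/
def NullHomotopicIn {S X : Type*} [TopologicalSpace S] [TopologicalSpace X]
    (f : C(S, X)) (U : Set X) : Prop :=
  ∃ (H : C(S × unitInterval, X)) (c : X),
    (∀ s : S, H (s, 0) = f s) ∧ (∀ s : S, H (s, 1) = c) ∧ ∀ z, H z ∈ U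

/-- `X` is locally `k`-connected: every neighborhood `U` of a point contains a
neighborhood `V` of the point such that every map of the `k`-sphere into `V` is
null-homotopic in `U`. -/
def LocallyKConnected (k : ℕ) (X : Type*) [TopologicalSpace X] : Prop :=
  ∀ (x : X) (U : Set X), IsOpen U → x ∈ U →
    ∃ V : Set X, IsOpen V ∧ x ∈ V ∧
      ∀ f : C(Metric.sphere (0 : EuclideanSpace ℝ (Fin (k + 1))) 1, X),
        (∀ s, f s ∈ V) → NullHomotopicIn f U

/-- `A` is a deformation retract of `B` (both subsets of an ambient space `X`). -/
def IsDeformationRetractOf {X : Type*} [TopologicalSpace X] (A B : Set X) : Prop :=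
  A ⊆ B ∧ ∃ H : C(B × unitInterval, X),
    (∀ b : B, H (b, 0) = ↑b) ∧ (∀ b : B, H (b, 1) ∈ A) ∧
    (∀ (b : B) (t : unitInterval), H (b, t) ∈ B) ∧
    ∀ b : B, (b : X) ∈ A → H (b, 1) = ↑b

/-! ### Simplicial complexes and their metric realizations -/

/-- An abstract simplicial complex on a vertex type `V`. -/
structure SComplex (V : Type*) where
  faces : Set (Finset V)
  nonempty_of_mem : ∀ s ∈ faces, s.Nonempty
  down_closed : ∀ s ∈ faces, ∀ t : Finset V, t ⊆ s → t.Nonempty → t ∈ faces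

namespace SComplex

variable {V W : Type*}

/-- The geometric realization with scale `κ` of a simplicial complex, i.e. the polyhedron,
as a subset of `ℓ¹(V)`: nonnegative functions supported on a simplex whose coordinates sum
to `κ` (each vertex `v` is the point `κ·e_v`).  It carries the metric topology induced from
the `ℓ¹`-norm. -/
def space (K : SComplex V) (κ : ℝ) : Set (lp (fun _ : V => ℝ) 1) :=
  {x | (∀ v, 0 ≤ x v) ∧ (∃ s ∈ K.faces, ∀ v, x v ≠ 0 → v ∈ s) ∧
    HasSum (fun v => x v) κ}

/-- The closed geometric simplex of the realization spanned by a face `s`. -/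
def cell (K : SComplex V) (κ : ℝ) (s : Finset V) : Set (K.space κ) :=
  {x | ∀ v, (x : lp (fun _ : V => ℝ) 1) v ≠ 0 → v ∈ s}

/-- The simplices of the barycentric subdivision `βK` are the nonempty finite chains
of faces of `K`. -/
def IsChainOfFaces (K : SComplex V) (c : Finset (Finset V)) : Prop :=
  c.Nonempty ∧ (∀ s ∈ c, s ∈ K.faces) ∧ ∀ s₁ ∈ c, ∀ s₂ ∈ c, s₁ ⊆ s₂ ∨ s₂ ⊆ s₁

/-- The closed geometric simplex of the barycentric subdivision `βK` spanned by the chain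
`c`, viewed inside the realization of `K`: the convex hull of the barycenters of the
faces in `c`. -/
def chainCell (K : SComplex V) (κ : ℝ) (c : Finset (Finset V)) : Set (K.space κ) :=
  {y | ∃ t : Finset V → ℝ, (∀ s, 0 ≤ t s) ∧ (∀ s, t s ≠ 0 → s ∈ c) ∧
      (∑ s ∈ c, t s) = κ ∧
      ∀ w, (y : lp (fun _ : V => ℝ) 1) w =
        ∑ s ∈ c, (if w ∈ s then t s / (s.card : ℝ) else 0)}

/-- A set of faces forms a subcomplex of `K`. -/
def IsSubcomplex (K : SComplex V) (F : Set (Finset V)) : Prop :=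
  F ⊆ K.faces ∧ ∀ s ∈ F, ∀ t : Finset V, t ⊆ s → t.Nonempty → t ∈ F

/-- The point set of the subcomplex with faces `F`, inside the realization of `K`. -/
def subSpace (K : SComplex V) (κ : ℝ) (F : Set (Finset V)) : Set (K.space κ) :=
  {x | ∃ s ∈ F, ∀ v, (x : lp (fun _ : V => ℝ) 1) v ≠ 0 → v ∈ s}

/-- The barycentric star of a subcomplex `F` in `K`: the union of the simplices of the
barycentric subdivision `βK` that intersect the subcomplex. -/
def bst (K : SComplex V) (κ : ℝ) (F : Set (Finset V)) : Set (K.space κ) :=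
  ⋃ c ∈ {c | K.IsChainOfFaces c ∧ (K.chainCell κ c ∩ K.subSpace κ F).Nonempty},
    K.chainCell κ c

/-- The open star of a subcomplex `F` in `K`: the complement of the union of all
simplices of `K` that do not intersect the subcomplex. -/
def ost (K : SComplex V) (κ : ℝ) (F : Set (Finset V)) : Set (K.space κ) :=
  (⋃ s ∈ {s | s ∈ K.faces ∧ K.cell κ s ∩ K.subSpace κ F = ∅}, K.cell κ s)ᶜ

/-- The open star of a subcomplex `F` taken in the barycentric subdivision `βK`:
the complement of the union of all simplices of `βK` that do not intersect the
subcomplex. -/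
def ostBsd (K : SComplex V) (κ : ℝ) (F : Set (Finset V)) : Set (K.space κ) :=
  (⋃ c ∈ {c | K.IsChainOfFaces c ∧ K.chainCell κ c ∩ K.subSpace κ F = ∅},
    K.chainCell κ c)ᶜ

/-- Barycentric star of a vertex. -/
def bstVertex (K : SComplex V) (κ : ℝ) (v : V) : Set (K.space κ) :=
  K.bst κ {({v} : Finset V)}

/-- Open star of a vertex. -/
def ostVertex (K : SComplex V) (κ : ℝ) (v : V) : Set (K.space κ) :=
  K.ost κ {({v} : Finset V)}

/-- A simplicial complex is locally finite-dimensional if the simplices containing any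
given vertex have bounded dimension. -/
def LocallyFiniteDimensional (K : SComplex V) : Prop :=
  ∀ v : V, {v} ∈ K.faces → ∃ N : ℕ, ∀ s ∈ K.faces, v ∈ s → s.card ≤ N

/-- `p` is a simplicial map of the realizations (scales `κ`, `lam`): it is induced by a
vertex map `φ` carrying faces onto faces, extended affinely on each simplex. -/
def IsSimplicialMap (K : SComplex V) (L : SComplex W) (κ lam : ℝ)
    (p : K.space κ → L.space lam) : Prop :=
  ∃ φ : V → W,
    (∀ s ∈ K.faces, ∃ t ∈ L.faces,
      (∀ v ∈ s, φ v ∈ t) ∧ ∀ w ∈ t, ∃ v ∈ s, φ v = w) ∧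
    ∀ (x : K.space κ) (w : W),
      (p x : lp (fun _ : W => ℝ) 1) w =
        (lam / κ) * ∑' v : V, (if φ v = w then (x : lp (fun _ : V => ℝ) 1) v else 0)

/-- `p` is quasi-simplicial: it is simplicial as a map into the barycentric subdivision
`βL`, i.e. induced by a vertex map `φ` from vertices of `K` to faces of `L` (the vertices
of `βL`) carrying each face of `K` into a chain, extended affinely; the formula is the
composition of the simplicial extension with the canonical identification `|βL| = |L|`
sending the vertex `s` of `βL` to the barycenter of `s`. -/
def IsQuasiSimplicialMap (K : SComplex V) (L : SComplex W) (κ lam : ℝ)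
    (p : K.space κ → L.space lam) : Prop :=
  ∃ φ : V → Finset W,
    (∀ v : V, ({v} : Finset V) ∈ K.faces → φ v ∈ L.faces) ∧
    (∀ s ∈ K.faces, ∀ v₁ ∈ s, ∀ v₂ ∈ s, φ v₁ ⊆ φ v₂ ∨ φ v₂ ⊆ φ v₁) ∧
    ∀ (x : K.space κ) (w : W),
      (p x : lp (fun _ : W => ℝ) 1) w =
        (lam / κ) *
          ∑' v : V, (if w ∈ φ v then (x : lp (fun _ : V => ℝ) 1) v / ((φ v).card : ℝ)
            else 0)

/-- A quasi-simplicial map is `n`-regular if the preimage of every (closed) simplex of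
the barycentric subdivision `βL` has vanishing homotopy groups in dimensions `< n`,
regardless of basepoint. -/
def IsNRegularMap (n : ℕ) (K : SComplex V) (L : SComplex W) (κ lam : ℝ)
    (p : K.space κ → L.space lam) : Prop :=
  IsQuasiSimplicialMap K L κ lam p ∧
    ∀ c : Finset (Finset W), L.IsChainOfFaces c →
      VanishingHomotopyBelow n (p ⁻¹' (L.chainCell lam c))

end SComplex

/-! ### Inverse limits -/

/-- The long projection of an inverse limit (realized as the subspace of the product
consisting of all threads) onto its `i`-th coordinate space. -/
def invLimProj {Z : ℕ → Type*} [∀ i, TopologicalSpace (Z i)]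
    (p : ∀ i, C(Z (i + 1), Z i)) (i : ℕ) :
    C({x : ∀ j, Z j // ∀ j, p j (x (j + 1)) = x j}, Z i) :=
  ⟨fun x => x.1 i, (continuous_apply i).comp continuous_subtype_val⟩

/-- The short projections of an inverse sequence: `shortProj p i m : Z (i + m) → Z i`. -/
def shortProj {Z : ℕ → Type*} [∀ i, TopologicalSpace (Z i)]
    (p : ∀ i, C(Z (i + 1), Z i)) (i : ℕ) : ∀ m : ℕ, C(Z (i + m), Z i)
  | 0 => ContinuousMap.id _
  | m + 1 => (shortProj p i m).comp (p (i + m))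

end


section Aux

open Topology Filter

theorem aux_dugundji {Y E : Type*} [MetricSpace Y] [NormedAddCommGroup E] [NormedSpace ℝ E]
    (A : Set Y) (hA : IsClosed A) (hne : A.Nonempty) (D : Set E) (hD : Convex ℝ D)
    (f : A → E) (hf : Continuous f) (hfD : ∀ a, f a ∈ D) :
    ∃ F : Y → E, Continuous F ∧ (∀ y, F y ∈ D) ∧ ∀ a : A, F a = f a := by
  let t : (Aᶜ : Set Y) → Set E := fun z =>
    convexHull ℝ (f '' {a | dist (z : Y) (a : Y) < 2 * infDist (z : Y) A})
  have hloc : ∀ z : (Aᶜ : Set Y), ∃ c : E, ∀ᶠ y in 𝓝 z, c ∈ t y := by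
    intro z
    have hpos : 0 < infDist (z : Y) A := (hA.notMem_iff_infDist_pos hne).1 z.2
    obtain ⟨a, haA, ha⟩ := (infDist_lt_iff (r := 2 * infDist (z : Y) A) hne).1 (by linarith)
    refine ⟨f ⟨a, haA⟩, ?_⟩
    have hopen : IsOpen {y : (Aᶜ : Set Y) | dist (y : Y) a < 2 * infDist (y : Y) A} := by
      apply isOpen_lt
      · fun_prop
      · exact continuous_const.mul ((continuous_infDist_pt A).comp continuous_subtype_val)
    filter_upwards [hopen.mem_nhds ha] with y hy
    exact subset_convexHull ℝ _ ⟨⟨a, haA⟩, hy, rfl⟩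
  obtain ⟨g, hg⟩ := exists_continuous_forall_mem_convex_of_local_const
    (fun z => convex_convexHull ℝ _) hloc
  let F : Y → E := fun y => if h : y ∈ A then f ⟨y, h⟩ else g ⟨y, h⟩
  have hFA : ∀ a : A, F a = f a := fun a => by simp [F]
  have hFn : ∀ y (h : y ∉ A), F y = g ⟨y, h⟩ := fun y h => by simp [F, h]
  refine ⟨F, ?_, ?_, hFA⟩
  · rw [continuous_iff_continuousAt]
    intro y
    by_cases hy : y ∈ A
    · rw [Metric.continuousAt_iff]
      intro ε hε
      obtain ⟨δ, hδ, hfδ⟩ := Metric.continuous_iff.1 hf ⟨y, hy⟩ ε hε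
      refine ⟨δ / 3, by positivity, ?_⟩
      intro z hz
      rw [hFA ⟨y, hy⟩]
      by_cases hzA : z ∈ A
      · rw [hFA ⟨z, hzA⟩]
        apply hfδ
        change dist z y < δ
        linarith
      · rw [hFn z hzA]
        have h1 : t ⟨z, hzA⟩ ⊆ ball (f ⟨y, hy⟩) ε := by
          apply convexHull_min _ (convex_ball _ _)
          rintro _ ⟨a, ha, rfl⟩
          apply hfδ
          change dist (a : Y) y < δ
          have ha' : dist z (a : Y) < 2 * infDist z A := ha
          have h2 : infDist z A ≤ dist z y := infDist_le_dist_of_mem hy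
          have h3 := dist_triangle (a : Y) z y
          rw [dist_comm (a : Y) z] at h3
          linarith
        exact h1 (hg _)
    · have h1 : ContinuousOn F Aᶜ := by
        rw [continuousOn_iff_continuous_domRestrict]
        convert g.continuous using 1
        ext z
        exact hFn z z.2
      exact h1.continuousAt (hA.isOpen_compl.mem_nhds hy)
  · intro y
    by_cases hy : y ∈ A
    · rw [hFA ⟨y, hy⟩]; exact hfD _
    · rw [hFn y hy]
      refine convexHull_min ?_ hD (hg ⟨y, hy⟩)
      rintro _ ⟨a, -, rfl⟩
      exact hfD a

variable {V : Type*}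

/-- Truncation `(x - c)^+`. -/
noncomputable def auxPsi (x : lp (fun _ : V => ℝ) 1) (c : ℝ) : lp (fun _ : V => ℝ) 1 :=
  ⟨fun v => max (x v - max c 0) 0, by
    refine memℓp_gen (Summable.of_nonneg_of_le (fun v => by positivity) (fun v => ?_)
      ((lp.memℓp x).summable (by simp)))
    simp only [ENNReal.toReal_one, Real.rpow_one, Real.norm_eq_abs]
    rw [abs_of_nonneg (le_max_right _ _)]
    have := le_max_right c 0
    exact max_le (by linarith [le_abs_self (x v)]) (abs_nonneg _)⟩

theorem auxPsi_apply (x : lp (fun _ : V => ℝ) 1) {c : ℝ} (hc : 0 ≤ c) (v : V) :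
    auxPsi x c v = max (x v - c) 0 := by
  change max (x v - max c 0) 0 = _
  rw [max_eq_left hc]

theorem auxPsi_nonneg (x : lp (fun _ : V => ℝ) 1) (c : ℝ) (v : V) : 0 ≤ auxPsi x c v :=
  le_max_right _ _

theorem aux_hasSum_norm (x : lp (fun _ : V => ℝ) 1) (hx : ∀ v, 0 ≤ x v) :
    HasSum (fun v => x v) ‖x‖ := by
  have := lp.hasSum_norm (p := 1) (by simp) x
  simpa [abs_of_nonneg (hx _)] using this

theorem aux_norm_le (x y : lp (fun _ : V => ℝ) 1) (h : ∀ v, |x v| ≤ |y v|) : ‖x‖ ≤ ‖y‖ := by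
  have h1 := lp.hasSum_norm (p := 1) (by simp) x
  have h2 := lp.hasSum_norm (p := 1) (by simp) y
  have := hasSum_le (fun v => by simpa using h v) h1 h2
  simpa using this

theorem aux_apply_le (x : lp (fun _ : V => ℝ) 1) (v : V) : |x v| ≤ ‖x‖ :=
  lp.norm_apply_le_norm (by simp) x v

theorem auxPsi_continuousAt (x₀ : lp (fun _ : V => ℝ) 1) (hx : {v | x₀ v ≠ 0}.Finite) (c₀ : ℝ) :
    ContinuousAt (fun p : lp (fun _ : V => ℝ) 1 × ℝ => auxPsi p.1 p.2) (x₀, c₀) := by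
  have h1 : ∀ x c, ‖auxPsi x c - auxPsi x₀ c‖ ≤ ‖x - x₀‖ := by
    intro x c
    apply aux_norm_le
    intro v
    change |max (x v - max c 0) 0 - max (x₀ v - max c 0) 0| ≤ |x v - x₀ v|
    refine (abs_max_sub_max_le_abs _ _ _).trans (le_of_eq ?_)
    congr 1; ring
  have h2 : ∀ c, auxPsi x₀ c = ∑ v ∈ hx.toFinset, lp.single 1 v (max (x₀ v - max c 0) 0) := by
    intro c
    ext v
    have h0 : auxPsi x₀ c v = max (x₀ v - max c 0) 0 := rfl
    rw [h0, lp.coeFn_sum, Finset.sum_apply]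
    simp only [lp.single_apply, Pi.single_apply]
    rw [Finset.sum_ite_eq]
    split_ifs with h
    · rfl
    · have : x₀ v = 0 := by simpa using h
      rw [this]
      apply max_eq_right
      have := le_max_right c 0
      linarith
  have h3 : Continuous (fun c => auxPsi x₀ c) := by
    simp_rw [h2]
    refine continuous_finsetSum _ fun v _ => ?_
    exact (lp.isometry_single (E := fun _ : V => ℝ) (p := 1) v).continuous.comp (by fun_prop)
  rw [ContinuousAt, tendsto_iff_norm_sub_tendsto_zero]
  have h4 : Tendsto (fun p : lp (fun _ : V => ℝ) 1 × ℝ =>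
      ‖p.1 - x₀‖ + ‖auxPsi x₀ p.2 - auxPsi x₀ c₀‖) (𝓝 (x₀, c₀)) (𝓝 0) := by
    have : Continuous (fun p : lp (fun _ : V => ℝ) 1 × ℝ =>
      ‖p.1 - x₀‖ + ‖auxPsi x₀ p.2 - auxPsi x₀ c₀‖) := by
      have := h3.comp (continuous_snd : Continuous (Prod.snd : lp (fun _ : V => ℝ) 1 × ℝ → ℝ))
      exact (continuous_fst.sub continuous_const).norm.add (this.sub continuous_const).norm
    simpa using this.tendsto (x₀, c₀)
  refine squeeze_zero (fun _ => norm_nonneg _) (fun p => ?_) h4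
  calc _ ≤ ‖auxPsi p.1 p.2 - auxPsi x₀ p.2‖ + ‖auxPsi x₀ p.2 - auxPsi x₀ c₀‖ :=
        norm_sub_le_norm_sub_add_norm_sub _ _ _
    _ ≤ _ := by gcongr; exact h1 _ _

/-- The infimum of levels `c ≥ 0` whose strict superlevel set lies in a face of `F`. -/
noncomputable def auxM (F : Set (Finset V)) (x : lp (fun _ : V => ℝ) 1) : ℝ :=
  sInf {c | 0 ≤ c ∧ ∃ s ∈ F, ∀ v, c < x v → v ∈ s}

theorem auxM_bdd (F : Set (Finset V)) (x : lp (fun _ : V => ℝ) 1) :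
    BddBelow {c | 0 ≤ c ∧ ∃ s ∈ F, ∀ v, c < x v → v ∈ s} := ⟨0, fun _ h => h.1⟩

theorem auxM_ne {F : Set (Finset V)} (hF : F.Nonempty) (x : lp (fun _ : V => ℝ) 1) :
    {c | 0 ≤ c ∧ ∃ s ∈ F, ∀ v, c < x v → v ∈ s}.Nonempty := by
  obtain ⟨s, hs⟩ := hF
  refine ⟨‖x‖, norm_nonneg _, s, hs, fun v hv => ?_⟩
  have := (le_abs_self _).trans (aux_apply_le x v)
  linarith

theorem auxM_nonneg (F : Set (Finset V)) (x : lp (fun _ : V => ℝ) 1) : 0 ≤ auxM F x :=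
  Real.sInf_nonneg fun _ h => h.1

theorem auxM_le {F : Set (Finset V)} {x : lp (fun _ : V => ℝ) 1} {c : ℝ} (hc : 0 ≤ c)
    {s : Finset V} (hs : s ∈ F) (h : ∀ v, c < x v → v ∈ s) : auxM F x ≤ c :=
  csInf_le (auxM_bdd F x) ⟨hc, s, hs, h⟩

theorem auxM_continuous {F : Set (Finset V)} (hF : F.Nonempty) :
    Continuous (auxM F) := by
  refine (LipschitzWith.of_le_add fun x y => ?_).continuous
  rw [← sub_le_iff_le_add]
  refine le_csInf (auxM_ne hF y) ?_
  rintro c ⟨hc, s, hs, h⟩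
  rw [sub_le_iff_le_add]
  refine auxM_le (by positivity) hs fun v hv => h v ?_
  have := (le_abs_self _).trans (aux_apply_le (x - y) v)
  rw [← dist_eq_norm] at this
  have h2 : (x - y) v = x v - y v := rfl
  rw [h2] at this
  linarith

theorem auxM_spec {F : Set (Finset V)} (hF : F.Nonempty) {x : lp (fun _ : V => ℝ) 1}
    (hx : {v | x v ≠ 0}.Finite) : ∃ s ∈ F, ∀ v, auxM F x < x v → v ∈ s := by
  have hfin : {v | auxM F x < x v}.Finite := hx.subset fun v hv => by
    have h1 := auxM_nonneg F x
    have hv' : auxM F x < x v := hv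
    exact (lt_of_le_of_lt h1 hv').ne'
  have : ∃ b, auxM F x < b ∧ ∀ v, auxM F x < x v → b ≤ x v := by
    rcases {v | auxM F x < x v}.eq_empty_or_nonempty with h | h
    · refine ⟨auxM F x + 1, by linarith, fun v hv => ?_⟩
      have : v ∈ {v | auxM F x < x v} := hv
      rw [h] at this; exact this.elim
    · obtain ⟨w, hw, hmin⟩ := Set.exists_min_image _ (fun v => x v) hfin h
      exact ⟨x w, hw, hmin⟩
  obtain ⟨b, hb, hb'⟩ := this
  obtain ⟨c, ⟨hc, s, hs, h⟩, hcb⟩ := exists_lt_of_csInf_lt (auxM_ne hF x) hb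
  exact ⟨s, hs, fun v hv => h v (hcb.trans_le (hb' v hv))⟩

theorem aux_eval_continuous (v : V) : Continuous (fun x : lp (fun _ : V => ℝ) 1 => x v) := by
  refine (LipschitzWith.of_le_add fun x y => ?_).continuous
  have := (le_abs_self _).trans (aux_apply_le (x - y) v)
  rw [← dist_eq_norm] at this
  have h2 : (x - y) v = x v - y v := rfl
  rw [h2] at this
  linarith

theorem aux_levels (S : Finset V) : ∀ (x : V → ℝ), (∀ v ∈ S, 0 < x v) → (∀ v, v ∉ S → x v = 0) →
    ∃ (c : Finset (Finset V)) (t : Finset V → ℝ), (∀ s, 0 ≤ t s) ∧ (∀ s, t s ≠ 0 → s ∈ c) ∧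
      (∀ s ∈ c, s.Nonempty ∧ ∃ a : ℝ, 0 ≤ a ∧ ∀ v, v ∈ s ↔ a < x v) ∧
      (∑ s ∈ c, t s) = ∑ v ∈ S, x v ∧
      ∀ w, x w = ∑ s ∈ c, (if w ∈ s then t s / (s.card : ℝ) else 0) := by
  induction S using Finset.strongInduction with
  | H S ih =>
    intro x hpos hzero
    rcases S.eq_empty_or_nonempty with hS | hS
    · subst hS
      exact ⟨∅, fun _ => 0, by simp, by simp, by simp, by simp, fun w => by simpa using hzero w⟩
    obtain ⟨v0, hv0, hmin⟩ := Finset.exists_min_image S x hS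
    have ha : 0 < x v0 := hpos v0 hv0
    have hx0 : ∀ v, 0 ≤ x v := fun v => by
      by_cases h : v ∈ S
      · exact (hpos v h).le
      · exact (hzero v h).ge
    let S' := S.filter (fun v => x v0 < x v)
    let x' : V → ℝ := fun v => if v ∈ S then x v - x v0 else 0
    have hS' : S' ⊂ S := by
      rw [Finset.ssubset_iff_of_subset (Finset.filter_subset _ _)]
      exact ⟨v0, hv0, by simp⟩
    obtain ⟨c, t, ht0, htc, hlev, hsum, hx⟩ := ih S' hS' x'
      (by
        intro v hv
        obtain ⟨h1, h2⟩ := Finset.mem_filter.1 hv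
        simp only [x', h1, if_true]; linarith)
      (by
        intro v hv
        by_cases h : v ∈ S
        · simp only [x', h, if_true]
          have h1 : ¬ x v0 < x v := fun h2 => hv (Finset.mem_filter.2 ⟨h, h2⟩)
          have := hmin v h
          linarith
        · simp [x', h])
    have hSc : S ∉ c := by
      intro h
      obtain ⟨-, a, ha0, ha1⟩ := hlev S h
      have := (ha1 v0).1 hv0
      simp [x', hv0] at this
      linarith
    have hcard : (0 : ℝ) < S.card := by exact_mod_cast hS.card_pos
    have hupd : ∀ s ∈ c, Function.update t S (x v0 * S.card) s = t s := fun s hs =>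
      Function.update_of_ne (by rintro rfl; exact hSc hs) _ _
    refine ⟨insert S c, Function.update t S (x v0 * S.card), ?_, ?_, ?_, ?_, ?_⟩
    · intro s
      by_cases h : s = S
      · subst h; simp only [Function.update_self]; positivity
      · rw [Function.update_of_ne h]; exact ht0 s
    · intro s hs
      by_cases h : s = S
      · subst h; simp
      · rw [Function.update_of_ne h] at hs
        exact Finset.mem_insert_of_mem (htc s hs)
    · intro s hs
      rcases Finset.mem_insert.1 hs with h | h
      · subst h
        refine ⟨hS, 0, le_rfl, fun v => ⟨hpos v, fun h => ?_⟩⟩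
        by_contra hv
        exact h.ne' (hzero v hv)
      · obtain ⟨h1, a, ha0, ha1⟩ := hlev s h
        refine ⟨h1, a + x v0, by linarith, fun v => ?_⟩
        rw [ha1 v]
        by_cases hv : v ∈ S
        · simp only [x', hv, if_true]
          constructor <;> intro h <;> linarith
        · simp only [x', hv, if_false]
          rw [hzero v hv]
          constructor <;> intro h <;> linarith
    · rw [Finset.sum_insert hSc, Finset.sum_congr rfl hupd, hsum, Function.update_self]
      have h1 : ∑ v ∈ S', x' v = ∑ v ∈ S, x' v := by
        apply Finset.sum_subset (Finset.filter_subset _ _)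
        intro v hv hv'
        simp only [x', hv, if_true]
        have h1 : ¬ x v0 < x v := fun h2 => hv' (Finset.mem_filter.2 ⟨hv, h2⟩)
        have := hmin v hv
        linarith
      have h2 : ∑ v ∈ S, x' v = ∑ v ∈ S, (x v - x v0) :=
        Finset.sum_congr rfl fun v hv => by simp [x', hv]
      rw [h1, h2, Finset.sum_sub_distrib]
      simp
      ring
    · intro w
      rw [Finset.sum_insert hSc, Function.update_self]
      have h1 : ∑ s ∈ c, (if w ∈ s then Function.update t S (x v0 * S.card) s / (s.card : ℝ) else 0)
          = x' w := by
        rw [hx w]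
        exact Finset.sum_congr rfl fun s hs => by rw [hupd s hs]
      rw [h1]
      by_cases hw : w ∈ S
      · simp only [x', hw, if_true]
        field_simp
        ring
      · simp [x', hw, hzero w hw]

theorem aux_max (x : V → ℝ) (hx : {v | x v ≠ 0}.Finite) (hnn : ∀ v, 0 ≤ x v)
    (hpos : ∃ v, 0 < x v) : ∃ M : Finset V, M.Nonempty ∧ (∀ v, v ∈ M ↔ ∀ w, x w ≤ x v) ∧
      ∃ c : ℝ, 0 ≤ c ∧ (∃ v, c < x v) ∧ ∀ v, c < x v → v ∈ M := by
  obtain ⟨u, hu⟩ := hpos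
  obtain ⟨m, hm, hmax⟩ := Finset.exists_max_image hx.toFinset x ⟨u, by simpa using hu.ne'⟩
  have hmm : ∀ w, x w ≤ x m := by
    intro w
    by_cases h : x w = 0
    · rw [h]; exact hnn m
    · exact hmax w (by simpa using h)
  have hm0 : 0 < x m := hu.trans_le (hmm u)
  let M := hx.toFinset.filter (fun v => x m ≤ x v)
  have hM : ∀ v, v ∈ M ↔ ∀ w, x w ≤ x v := by
    intro v
    constructor
    · intro h w
      exact (hmm w).trans (Finset.mem_filter.1 h).2
    · intro h
      refine Finset.mem_filter.2 ⟨?_, h m⟩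
      have := h m
      have h3 : x v ≠ 0 := by linarith
      simpa using h3
  refine ⟨M, ⟨m, (hM m).2 hmm⟩, hM, ?_⟩
  rcases (hx.toFinset.filter (fun v => x v < x m)).eq_empty_or_nonempty with h | h
  · refine ⟨0, le_rfl, ⟨m, hm0⟩, fun v hv => ?_⟩
    refine Finset.mem_filter.2 ⟨by simpa using hv.ne', ?_⟩
    by_contra hlt
    have : v ∈ hx.toFinset.filter (fun v => x v < x m) :=
      Finset.mem_filter.2 ⟨by simpa using hv.ne', not_le.1 hlt⟩
    rw [h] at this; simp at this
  · obtain ⟨w, hw, hwmax⟩ := Finset.exists_max_image _ x h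
    refine ⟨x w, hnn w, ⟨m, (Finset.mem_filter.1 hw).2⟩, fun v hv => ?_⟩
    have hv0 : x v ≠ 0 := by have := hnn w; linarith
    refine Finset.mem_filter.2 ⟨by simpa using hv0, ?_⟩
    by_contra hlt
    have := hwmax v (Finset.mem_filter.2 ⟨by simpa using hv0, not_le.1 hlt⟩)
    linarith

theorem aux_fin {K : SComplex V} {κ : ℝ} (x : K.space κ) :
    {v | (x : lp (fun _ : V => ℝ) 1) v ≠ 0}.Finite := by
  obtain ⟨-, ⟨s, -, hs⟩, -⟩ := x.2
  exact s.finite_toSet.subset fun v hv => hs v hv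

theorem aux_pos {K : SComplex V} {κ : ℝ} (hκ : 0 < κ) (x : K.space κ) :
    ∃ v, 0 < (x : lp (fun _ : V => ℝ) 1) v := by
  by_contra! h
  have h0 : (fun v => (x : lp (fun _ : V => ℝ) 1) v) = fun _ => 0 := by
    funext v
    exact le_antisymm (h v) (x.2.1 v)
  have h1 := x.2.2.2
  rw [h0] at h1
  exact hκ.ne (hasSum_zero.unique h1)

theorem aux_bary (K : SComplex V) (κ : ℝ) (hκ : 0 < κ) {s : Finset V} (hs : s ∈ K.faces) :
    ∃ x : K.space κ, ∀ v, (x : lp (fun _ : V => ℝ) 1) v = if v ∈ s then κ / (s.card : ℝ) else 0 := by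
  let x : lp (fun _ : V => ℝ) 1 := ∑ v ∈ s, lp.single 1 v (κ / (s.card : ℝ))
  have hx : ∀ v, x v = if v ∈ s then κ / (s.card : ℝ) else 0 := by
    intro v
    simp only [x]
    rw [lp.coeFn_sum, Finset.sum_apply]
    simp only [lp.single_apply, Pi.single_apply]
    rw [Finset.sum_ite_eq]
  have hcard : (0 : ℝ) < s.card := by exact_mod_cast (K.nonempty_of_mem s hs).card_pos
  refine ⟨⟨x, ?_, ⟨s, hs, ?_⟩, ?_⟩, hx⟩
  · intro v
    rw [hx]; split_ifs <;> positivity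
  · intro v hv
    by_contra h
    rw [hx] at hv
    simp [h] at hv
  · have h1 : (fun v => x v) = fun v => if v ∈ s then κ / (s.card : ℝ) else 0 := funext hx
    rw [h1]
    have h2 : HasSum (fun v => if v ∈ s then κ / (s.card : ℝ) else 0)
        (∑ v ∈ s, if v ∈ s then κ / (s.card : ℝ) else 0) :=
      hasSum_sum_of_ne_finset_zero fun v hv => by simp [hv]
    convert h2 using 1
    rw [Finset.sum_congr rfl (fun v hv => if_pos hv)]
    simp
    field_simp

theorem aux_mem_ost {K : SComplex V} {κ : ℝ} (hκ : 0 < κ) {F : Set (Finset V)}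
    (hF : K.IsSubcomplex F) (x : K.space κ) :
    x ∈ K.ostBsd κ F ↔ ∃ s ∈ F, ∀ v, (∀ w, (x : lp (fun _ : V => ℝ) 1) w ≤
      (x : lp (fun _ : V => ℝ) 1) v) → v ∈ s := by
  obtain ⟨hnn, ⟨S0, hS0, hS0'⟩, hsumx⟩ := x.2
  constructor
  · intro hx
    let S := (aux_fin x).toFinset
    have hSmem : ∀ v, v ∈ S ↔ (x : lp (fun _ : V => ℝ) 1) v ≠ 0 := fun v => by simp [S]
    obtain ⟨c, t, ht0, htc, hlev, hsum, hxc⟩ := aux_levels S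
      (fun v => (x : lp (fun _ : V => ℝ) 1) v)
      (fun v hv => lt_of_le_of_ne (hnn v) ((hSmem v).1 hv).symm)
      (fun v hv => by by_contra h; exact hv ((hSmem v).2 h))
    have hsumκ : ∑ v ∈ S, (x : lp (fun _ : V => ℝ) 1) v = κ := by
      refine HasSum.unique (hasSum_sum_of_ne_finset_zero fun v hv => ?_) hsumx
      by_contra h; exact hv ((hSmem v).2 h)
    rw [hsumκ] at hsum
    have hchain : K.IsChainOfFaces c := by
      refine ⟨?_, ?_, ?_⟩
      · by_contra h
        rw [Finset.not_nonempty_iff_eq_empty] at h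
        subst h
        simp at hsum
        exact hκ.ne hsum
      · intro s hs
        obtain ⟨h1, a, ha0, ha⟩ := hlev s hs
        refine K.down_closed S0 hS0 s (fun v hv => hS0' v ?_) h1
        have := (ha v).1 hv
        exact (lt_of_le_of_lt ha0 this).ne'
      · intro s₁ hs₁ s₂ hs₂
        obtain ⟨-, a, -, ha⟩ := hlev s₁ hs₁
        obtain ⟨-, b, -, hb⟩ := hlev s₂ hs₂
        rcases le_total a b with h | h
        · right
          intro v hv
          exact (ha v).2 (h.trans_lt ((hb v).1 hv))
        · left
          intro v hv
          exact (hb v).2 (h.trans_lt ((ha v).1 hv))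
    have hxcell : x ∈ K.chainCell κ c := ⟨t, ht0, htc, hsum, hxc⟩
    have hne : K.chainCell κ c ∩ K.subSpace κ F ≠ ∅ := by
      intro h
      apply hx
      exact mem_iUnion₂.2 ⟨c, ⟨hchain, h⟩, hxcell⟩
    obtain ⟨z, ⟨τ, hτ0, hτc, hτsum, hz⟩, s', hs', hzs'⟩ := nonempty_iff_ne_empty.2 hne
    obtain ⟨s, hs, hτs⟩ : ∃ s ∈ c, τ s ≠ 0 := by
      by_contra! h
      rw [Finset.sum_eq_zero h] at hτsum
      exact hκ.ne hτsum
    obtain ⟨hsne, a, ha0, ha⟩ := hlev s hs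
    have hss' : s ⊆ s' := by
      intro v hv
      apply hzs'
      rw [hz]
      apply ne_of_gt
      apply Finset.sum_pos'
      · intro r _
        have := hτ0 r
        split_ifs <;> positivity
      · refine ⟨s, hs, ?_⟩
        rw [if_pos hv]
        have h1 : (0 : ℝ) < s.card := by exact_mod_cast hsne.card_pos
        have h2 : 0 < τ s := lt_of_le_of_ne (hτ0 s) hτs.symm
        positivity
    refine ⟨s, hF.2 s' hs' s hss' hsne, fun v hv => ?_⟩
    obtain ⟨u, hu⟩ := hsne
    exact (ha v).2 (((ha u).1 hu).trans_le (hv u))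
  · rintro ⟨s, hs, hM⟩ hx
    obtain ⟨c, ⟨hchain, hempty⟩, t, ht0, htc, htsum, hxt⟩ := mem_iUnion₂.1 hx
    have hne : (c.filter (fun s => t s ≠ 0)).Nonempty := by
      by_contra h
      rw [Finset.not_nonempty_iff_eq_empty, Finset.filter_eq_empty_iff] at h
      rw [Finset.sum_eq_zero (fun s hs => not_not.1 (h hs))] at htsum
      exact hκ.ne htsum
    obtain ⟨s0, hs0, hmin⟩ := Finset.exists_min_image _ Finset.card hne
    obtain ⟨hs0c, hts0⟩ := Finset.mem_filter.1 hs0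
    have hsub : ∀ r, t r ≠ 0 → s0 ⊆ r := by
      intro r hr
      rcases hchain.2.2 s0 hs0c r (htc r hr) with h | h
      · exact h
      · exact (Finset.eq_of_subset_of_card_le h
          (hmin r (Finset.mem_filter.2 ⟨htc r hr, hr⟩))).ge
    have hs0s : s0 ⊆ s := by
      intro v hv
      apply hM
      intro w
      rw [hxt, hxt]
      apply Finset.sum_le_sum
      intro r _
      by_cases hr : t r = 0
      · simp [hr]
      · rw [if_pos (hsub r hr hv)]
        have := ht0 r
        split_ifs
        · exact le_rfl
        · positivity
    have hs0face := hchain.2.1 s0 hs0c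
    have hs0F : s0 ∈ F := hF.2 s hs s0 hs0s (K.nonempty_of_mem s0 hs0face)
    obtain ⟨b, hb⟩ := aux_bary K κ hκ hs0face
    have : b ∈ K.chainCell κ c ∩ K.subSpace κ F := by
      refine ⟨⟨fun r => if r = s0 then κ else 0, ?_, ?_, ?_, ?_⟩, s0, hs0F, ?_⟩
      · intro r; dsimp only; split_ifs <;> linarith
      · intro r hr
        by_cases h : r = s0
        · rw [h]; exact hs0c
        · simp [h] at hr
      · simp [hs0c]
      · intro w
        rw [hb, Finset.sum_eq_single s0]
        · simp
        · intro r _ hr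
          simp [hr]
        · intro h; exact (h hs0c).elim
      · intro v hv
        by_contra h
        rw [hb] at hv
        simp [h] at hv
    rw [hempty] at this
    exact this

theorem aux_mem_ost' {K : SComplex V} {κ : ℝ} (hκ : 0 < κ) {F : Set (Finset V)}
    (hF : K.IsSubcomplex F) (hne : F.Nonempty) (x : K.space κ) :
    x ∈ K.ostBsd κ F ↔ ∃ v, auxM F x < (x : lp (fun _ : V => ℝ) 1) v := by
  rw [aux_mem_ost hκ hF]
  constructor
  · rintro ⟨s, hs, h⟩
    obtain ⟨M, -, hM, c, hc, ⟨v, hv⟩, hcM⟩ := aux_max _ (aux_fin x) x.2.1 (aux_pos hκ x)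
    exact ⟨v, (auxM_le hc hs fun w hw => h w ((hM w).1 (hcM w hw))).trans_lt hv⟩
  · rintro ⟨v, hv⟩
    obtain ⟨s, hs, h⟩ := auxM_spec hne (aux_fin x)
    exact ⟨s, hs, fun w hw => h w (hv.trans_le (hw v))⟩

theorem aux_ost_open {K : SComplex V} {κ : ℝ} (hκ : 0 < κ) {F : Set (Finset V)}
    (hF : K.IsSubcomplex F) : IsOpen (K.ostBsd κ F) := by
  rcases F.eq_empty_or_nonempty with h | hne
  · have : K.ostBsd κ F = ∅ := by
      ext x
      rw [aux_mem_ost hκ hF]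
      simp [h]
    rw [this]
    exact isOpen_empty
  · have : K.ostBsd κ F = ⋃ v, {x : K.space κ | auxM F x < (x : lp (fun _ : V => ℝ) 1) v} := by
      ext x
      rw [aux_mem_ost' hκ hF hne]
      simp
    rw [this]
    refine isOpen_iUnion fun v => isOpen_lt ?_ ?_
    · exact (auxM_continuous hne).comp continuous_subtype_val
    · exact (aux_eval_continuous v).comp continuous_subtype_val

theorem aux_sub_subset_ost {K : SComplex V} {κ : ℝ} (hκ : 0 < κ) {F : Set (Finset V)}
    (hF : K.IsSubcomplex F) : K.subSpace κ F ⊆ K.ostBsd κ F := by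
  rintro x ⟨s, hs, h⟩
  rw [aux_mem_ost hκ hF]
  refine ⟨s, hs, fun v hv => h v ?_⟩
  obtain ⟨u, hu⟩ := aux_pos hκ x
  exact (hu.trans_le (hv u)).ne'

theorem aux_ost_nonempty {K : SComplex V} {κ : ℝ} (hκ : 0 < κ) {F : Set (Finset V)}
    (hF : K.IsSubcomplex F) : (K.ostBsd κ F).Nonempty ↔ (K.subSpace κ F).Nonempty := by
  constructor
  · rintro ⟨x, hx⟩
    obtain ⟨s, hs, -⟩ := (aux_mem_ost hκ hF x).1 hx
    obtain ⟨b, hb⟩ := aux_bary K κ hκ (hF.1 hs)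
    refine ⟨b, s, hs, fun v hv => ?_⟩
    by_contra h
    rw [hb] at hv
    simp [h] at hv
  · exact fun h => h.mono (aux_sub_subset_ost hκ hF)

theorem aux_inter_sub {ι : Type*} {K : SComplex V} {F : ι → Set (Finset V)}
    (hF : ∀ i, K.IsSubcomplex (F i)) {A : Set ι} (hA : A.Nonempty) :
    K.IsSubcomplex (⋂ i ∈ A, F i) := by
  obtain ⟨i, hi⟩ := hA
  refine ⟨fun s hs => (hF i).1 (mem_iInter₂.1 hs i hi), fun s hs t ht hne => ?_⟩
  exact mem_iInter₂.2 fun j hj => (hF j).2 s (mem_iInter₂.1 hs j hj) t ht hne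

theorem aux_inter_subSpace {ι : Type*} {K : SComplex V} {κ : ℝ} (hκ : 0 < κ)
    {F : ι → Set (Finset V)} (hF : ∀ i, K.IsSubcomplex (F i)) (A : Set ι) :
    (⋂ i ∈ A, K.subSpace κ (F i)) = K.subSpace κ (⋂ i ∈ A, F i) := by
  ext x
  rw [mem_iInter₂]
  constructor
  · intro h
    refine ⟨(aux_fin x).toFinset, mem_iInter₂.2 fun i hi => ?_, fun v hv => by simpa using hv⟩
    obtain ⟨s, hs, hsx⟩ := h i hi
    obtain ⟨u, hu⟩ := aux_pos hκ x
    exact (hF i).2 s hs _ (fun v hv => hsx v (by simpa using hv)) ⟨u, by simpa using hu.ne'⟩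
  · rintro ⟨s, hs, h⟩ i hi
    exact ⟨s, mem_iInter₂.1 hs i hi, h⟩

theorem aux_inter_ost {ι : Type*} {K : SComplex V} {κ : ℝ} (hκ : 0 < κ)
    {F : ι → Set (Finset V)} (hF : ∀ i, K.IsSubcomplex (F i)) (A : Set ι) (hA : A.Nonempty) :
    (⋂ i ∈ A, K.ostBsd κ (F i)) = K.ostBsd κ (⋂ i ∈ A, F i) := by
  ext x
  rw [mem_iInter₂, aux_mem_ost hκ (aux_inter_sub hF hA)]
  constructor
  · intro h
    obtain ⟨M, hMne, hM, -⟩ := aux_max _ (aux_fin x) x.2.1 (aux_pos hκ x)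
    refine ⟨M, mem_iInter₂.2 fun i hi => ?_, fun v hv => (hM v).2 hv⟩
    obtain ⟨s, hs, hsx⟩ := (aux_mem_ost hκ (hF i) x).1 (h i hi)
    exact (hF i).2 s hs _ (fun v hv => hsx v ((hM v).1 hv)) hMne
  · rintro ⟨s, hs, h⟩ i hi
    exact (aux_mem_ost hκ (hF i) x).2 ⟨s, mem_iInter₂.1 hs i hi, h⟩

/-- Finitely supported points of the full simplex. -/
def auxD (V : Type*) (κ : ℝ) : Set (lp (fun _ : V => ℝ) 1) :=
  {x | (∀ v, 0 ≤ x v) ∧ {v | x v ≠ 0}.Finite ∧ HasSum (fun v => x v) κ}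

theorem auxD_convex (κ : ℝ) : Convex ℝ (auxD V κ) := by
  rintro x ⟨hx0, hxf, hxs⟩ y ⟨hy0, hyf, hys⟩ a b ha hb hab
  have hv : ∀ v, (a • x + b • y) v = a * x v + b * y v := fun v => rfl
  refine ⟨fun v => ?_, ?_, ?_⟩
  · rw [hv]
    have := hx0 v
    have := hy0 v
    positivity
  · refine (hxf.union hyf).subset fun v h => ?_
    by_contra h2
    simp only [mem_union, mem_ofPred_eq, not_or, not_not] at h2
    apply h
    rw [hv, h2.1, h2.2]; simp
  · have h1 := (hxs.mul_left a).add (hys.mul_left b)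
    rw [← add_mul, hab, one_mul] at h1
    exact h1

/-- Normalized truncation. -/
noncomputable def auxPhi (κ : ℝ) (x : lp (fun _ : V => ℝ) 1) (c : ℝ) : lp (fun _ : V => ℝ) 1 :=
  (κ / ‖auxPsi x c‖) • auxPsi x c

theorem auxPsi_pos {x : lp (fun _ : V => ℝ) 1} {c : ℝ} (hc : 0 ≤ c) {v : V} (hv : c < x v) :
    0 < ‖auxPsi x c‖ := by
  have h := (le_abs_self _).trans (aux_apply_le (auxPsi x c) v)
  rw [auxPsi_apply x hc] at h
  have := le_max_left (x v - c) 0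
  linarith

theorem auxPhi_apply (κ : ℝ) (x : lp (fun _ : V => ℝ) 1) {c : ℝ} (hc : 0 ≤ c) (v : V) :
    auxPhi κ x c v = κ / ‖auxPsi x c‖ * max (x v - c) 0 := by
  rw [← auxPsi_apply x hc]; rfl

theorem auxPhi_mem {K : SComplex V} {κ : ℝ} (hκ : 0 < κ) {x : lp (fun _ : V => ℝ) 1} {c : ℝ}
    (hc : 0 ≤ c) (hv : ∃ v, c < x v) {s : Finset V} (hs : s ∈ K.faces)
    (h : ∀ v, c < x v → v ∈ s) : auxPhi κ x c ∈ K.space κ := by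
  obtain ⟨u, hu⟩ := hv
  have hp := auxPsi_pos hc hu
  refine ⟨fun v => ?_, ⟨s, hs, fun v hv => h v ?_⟩, ?_⟩
  · rw [auxPhi_apply κ x hc]
    exact mul_nonneg (by positivity) (le_max_right _ _)
  · by_contra hle
    apply hv
    rw [auxPhi_apply κ x hc, max_eq_right (by linarith), mul_zero]
  · have h1 := (aux_hasSum_norm (auxPsi x c) (auxPsi_nonneg x c)).mul_left (κ / ‖auxPsi x c‖)
    rw [div_mul_cancel₀ _ hp.ne'] at h1
    exact h1

theorem auxPhi_zero {κ : ℝ} (hκ : 0 < κ) {x : lp (fun _ : V => ℝ) 1} (hx : x ∈ auxD V κ) :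
    auxPhi κ x 0 = x := by
  have h1 : auxPsi x 0 = x := by
    ext v
    rw [auxPsi_apply x le_rfl, sub_zero, max_eq_left (hx.1 v)]
  have h2 : ‖x‖ = κ := (aux_hasSum_norm x hx.1).unique hx.2.2
  rw [auxPhi, h1, h2, div_self hκ.ne', one_smul]

theorem auxPhi_mem_ost {K : SComplex V} {κ : ℝ} (hκ : 0 < κ) {L : Set (Finset V)}
    (hL : K.IsSubcomplex L) (hne : L.Nonempty) {x : lp (fun _ : V => ℝ) 1} (hx : x ∈ auxD V κ)
    {c : ℝ} (hc : 0 ≤ c) (hcL : c ≤ auxM L x) (hv : ∃ v, auxM L x < x v)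
    (h : auxPhi κ x c ∈ K.space κ) :
    (⟨auxPhi κ x c, h⟩ : K.space κ) ∈ K.ostBsd κ L := by
  rw [aux_mem_ost hκ hL]
  obtain ⟨s, hs, hsx⟩ := auxM_spec hne hx.2.1
  obtain ⟨u, hu⟩ := hv
  refine ⟨s, hs, fun v hv => hsx v ?_⟩
  have hp : 0 < κ / ‖auxPsi x c‖ := div_pos hκ (auxPsi_pos hc (hcL.trans_lt hu))
  have h1 := hv u
  change auxPhi κ x c u ≤ auxPhi κ x c v at h1
  rw [auxPhi_apply κ x hc, auxPhi_apply κ x hc] at h1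
  have h2 := le_of_mul_le_mul_left h1 hp
  have h3 := (le_max_left _ _).trans h2
  by_contra hle
  push Not at hle
  rcases le_max_iff.1 h3 with h4 | h4 <;> linarith

theorem aux_main.{w, v} {V : Type v} (n : ℕ) {K : SComplex V} {κ : ℝ} (hκ : 0 < κ)
    {L : Set (Finset V)} (hL : K.IsSubcomplex L) (hne : L.Nonempty)
    (hAE : IsAE.{w} n (K.subSpace κ L)) : IsAE.{w} n (K.ostBsd κ L) := by
  intro Y _ hY A hA f
  rcases A.eq_empty_or_nonempty with hAe | hAne
  · obtain ⟨s, hs⟩ := hne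
    obtain ⟨b, hb⟩ := aux_bary K κ hκ (hL.1 hs)
    have hbL : b ∈ K.ostBsd κ L := aux_sub_subset_ost hκ hL
      ⟨s, hs, fun v hv => by by_contra h; rw [hb] at hv; simp [h] at hv⟩
    refine ⟨ContinuousMap.const _ ⟨b, hbL⟩, fun a => ?_⟩
    exact (eq_empty_iff_forall_notMem.1 hAe a a.2).elim
  have hKne : K.faces.Nonempty := hne.mono hL.1
  have hKL : ∀ x, auxM K.faces x ≤ auxM L x := fun x =>
    csInf_le_csInf (auxM_bdd _ x) (auxM_ne hne x)
      fun c ⟨hc, s, hs, h⟩ => ⟨hc, s, hL.1 hs, h⟩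
  obtain ⟨F, hFc, hFD, hFA⟩ := aux_dugundji A hA hAne (auxD V κ) (auxD_convex κ)
    (fun a => ((f a : K.space κ) : lp (fun _ : V => ℝ) 1))
    (continuous_subtype_val.comp (continuous_subtype_val.comp f.continuous))
    (fun a => ⟨(f a : K.space κ).2.1, aux_fin _, (f a : K.space κ).2.2.2⟩)
  let W : Set Y := {y | ∃ v, auxM L (F y) < F y v}
  have hW : IsOpen W := by
    have : W = ⋃ v, {y | auxM L (F y) < F y v} := by ext; simp [W]
    rw [this]
    exact isOpen_iUnion fun v => isOpen_lt ((auxM_continuous hne).comp hFc)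
      ((aux_eval_continuous v).comp hFc)
  have hAW : A ⊆ W := by
    intro a ha
    have := (aux_mem_ost' hκ hL hne (f ⟨a, ha⟩ : K.space κ)).1 (f ⟨a, ha⟩).2
    rw [← hFA ⟨a, ha⟩] at this
    exact this
  -- general continuity
  have hPhic : ∀ (c : Y → ℝ), Continuous c → (∀ y, 0 ≤ c y) → (∀ y, c y ≤ auxM L (F y)) →
      ContinuousOn (fun y => auxPhi κ (F y) (c y)) W := by
    intro c hc hc0 hcL y hy
    obtain ⟨v, hv⟩ := hy
    have h1 : ContinuousAt (fun y => auxPsi (F y) (c y)) y :=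
      ContinuousAt.comp (f := fun y => (F y, c y)) (auxPsi_continuousAt (F y) (hFD y).2.1 (c y))
        (hFc.prodMk hc).continuousAt
    have hp := auxPsi_pos (hc0 y) ((hcL y).trans_lt hv)
    exact ((continuousAt_const.div h1.norm hp.ne').smul h1).continuousWithinAt
  have hspace : ∀ y ∈ W, ∀ c, auxM K.faces (F y) ≤ c → c ≤ auxM L (F y) →
      auxPhi κ (F y) c ∈ K.space κ := by
    rintro y ⟨v, hv⟩ c h1 h2
    obtain ⟨s, hs, h⟩ := auxM_spec hKne (hFD y).2.1
    exact auxPhi_mem hκ ((auxM_nonneg _ _).trans h1) ⟨v, h2.trans_lt hv⟩ hs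
      fun w hw => h w (h1.trans_lt hw)
  obtain ⟨τ, hτ0, hτ1, hτ⟩ := exists_continuous_zero_one_of_isClosed hA hW.isClosed_compl
    (disjoint_compl_right_iff_subset.2 hAW)
  let C : Set Y := {y | τ y ≤ 1 / 2}
  have hC : IsClosed C := isClosed_le τ.continuous continuous_const
  have hCW : C ⊆ W := by
    intro y hy
    by_contra h
    have h1 : τ y = 1 := hτ1 h
    have h2 : τ y ≤ 1 / 2 := hy
    rw [h1] at h2
    norm_num at h2
  have hpmem : ∀ y : C, (⟨auxPhi κ (F y) (auxM L (F y)),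
      hspace y (hCW y.2) _ (hKL _) le_rfl⟩ : K.space κ) ∈ K.subSpace κ L := by
    intro y
    obtain ⟨s, hs, h⟩ := auxM_spec hne (hFD y).2.1
    refine ⟨s, hs, fun v hv => h v ?_⟩
    by_contra hle
    apply hv
    change auxPhi κ (F y) (auxM L (F y)) v = 0
    rw [auxPhi_apply κ _ (auxM_nonneg _ _), max_eq_right (by linarith), mul_zero]
  have hpc : Continuous (fun y : C => auxPhi κ (F y) (auxM L (F y))) := by
    have := (hPhic (fun y => auxM L (F y)) ((auxM_continuous hne).comp hFc)
      (fun y => auxM_nonneg _ _) (fun y => le_rfl)).mono hCW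
    exact continuousOn_iff_continuous_domRestrict.1 this
  let p : C(C, K.subSpace κ L) :=
    ⟨fun y => ⟨_, hpmem y⟩, (hpc.subtype_mk _).subtype_mk _⟩
  obtain ⟨h, hh⟩ := hAE Y hY C hC p
  let ρ : Y → ℝ := fun y => min (2 * τ y) 1
  have hrc : Continuous ρ := by fun_prop
  have hr0 : ∀ y, 0 ≤ ρ y := fun y => le_min (by linarith [(hτ y).1]) zero_le_one
  have hr1 : ∀ y, ρ y ≤ 1 := fun y => min_le_right _ _
  let c : Y → ℝ := fun y => auxM K.faces (F y) + ρ y * (auxM L (F y) - auxM K.faces (F y))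
  have hcc : Continuous c := by
    have h1 := (auxM_continuous hKne).comp hFc
    have h2 := (auxM_continuous hne).comp hFc
    exact h1.add (hrc.mul (h2.sub h1))
  have hcK : ∀ y, auxM K.faces (F y) ≤ c y := fun y => by
    have := mul_nonneg (hr0 y) (sub_nonneg.2 (hKL (F y)))
    simp only [c]; linarith
  have hcL : ∀ y, c y ≤ auxM L (F y) := fun y => by
    have := mul_le_mul_of_nonneg_right (hr1 y) (sub_nonneg.2 (hKL (F y)))
    simp only [c]; linarith
  have hc0 : ∀ y, 0 ≤ c y := fun y => (auxM_nonneg _ _).trans (hcK y)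
  let g : Y → lp (fun _ : V => ℝ) 1 := fun y =>
    if τ y ≤ 1 / 2 then auxPhi κ (F y) (c y) else ((h y : K.space κ) : lp (fun _ : V => ℝ) 1)
  have hgc : Continuous g := by
    refine continuous_if_le τ.continuous continuous_const ((hPhic c hcc hc0 hcL).mono hCW) ?_ ?_
    · exact (continuous_subtype_val.comp
        (continuous_subtype_val.comp h.continuous)).continuousOn
    · intro y hy
      have h1 := hh ⟨y, hy.le⟩
      have hr : ρ y = 1 := by simp [ρ, hy]
      have h2 : c y = auxM L (F y) := by simp only [c, hr]; ring
      change auxPhi κ (F y) (c y) = ((h y : K.space κ) : lp (fun _ : V => ℝ) 1)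
      rw [h1, h2]
      rfl
  have hgm : ∀ y, ∃ hy : g y ∈ K.space κ, (⟨g y, hy⟩ : K.space κ) ∈ K.ostBsd κ L := by
    intro y
    by_cases hy : τ y ≤ 1 / 2
    · have h1 : g y = auxPhi κ (F y) (c y) := if_pos hy
      rw [h1]
      exact ⟨hspace y (hCW hy) _ (hcK y) (hcL y),
        auxPhi_mem_ost hκ hL hne (hFD y) (hc0 y) (hcL y) (hCW hy) _⟩
    · have h1 : g y = ((h y : K.space κ) : lp (fun _ : V => ℝ) 1) := if_neg hy
      rw [h1]
      exact ⟨(h y : K.space κ).2, aux_sub_subset_ost hκ hL (h y).2⟩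
  refine ⟨⟨fun y => ⟨⟨g y, (hgm y).1⟩, (hgm y).2⟩, (hgc.subtype_mk _).subtype_mk _⟩, fun a => ?_⟩
  apply Subtype.ext
  apply Subtype.ext
  change g a = ((f a : K.space κ) : lp (fun _ : V => ℝ) 1)
  have hτa : τ a = 0 := hτ0 a.2
  have h1 : g a = auxPhi κ (F a) (c a) := if_pos (by rw [hτa]; norm_num)
  have hra : ρ a = 0 := by simp [ρ, hτa]
  have hMa : auxM K.faces (F a) = 0 := by
    apply le_antisymm _ (auxM_nonneg _ _)
    obtain ⟨hnn, ⟨s, hs, hsx⟩, -⟩ := (f a : K.space κ).2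
    rw [hFA a]
    exact auxM_le le_rfl hs fun v hv => hsx v hv.ne'
  have hca : c a = 0 := by simp [c, hra, hMa]
  rw [h1, hca, auxPhi_zero hκ (hFD _), hFA a]

end Aux

universe u

/-- If `K` is a polyhedron and `𝒦 = {K_i}` is an `AE(n)`-cover of `K`
by subcomplexes, then the collection of open stars of these subcomplexes taken in the
barycentric subdivision `βK` is an open `AE(n)`-cover of `K`; moreover, it is isomorphic
to `𝒦`. -/
theorem statement6 {V ι : Type*} (n : ℕ) (K : SComplex V) (κ : ℝ) (hκ : 0 < κ)
    (F : ι → Set (Finset V)) (hsub : ∀ i, K.IsSubcomplex (F i))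
    (hcov : IsAECover.{u} n (fun i => K.subSpace κ (F i))) :
    (∀ i, IsOpen (K.ostBsd κ (F i))) ∧
    IsAECover.{u} n (fun i => K.ostBsd κ (F i)) ∧
    CoversIsomorphic (fun i => K.ostBsd κ (F i)) (fun i => K.subSpace κ (F i)) := by
  refine ⟨fun i => aux_ost_open hκ (hsub i), ⟨?_, ?_⟩, ?_⟩
  · refine eq_univ_of_univ_subset ?_
    rw [← hcov.1]
    exact iUnion_mono fun i => aux_sub_subset_ost hκ (hsub i)
  · intro A hA
    have h := hcov.2 A hA
    dsimp only at h ⊢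
    rw [aux_inter_subSpace hκ hsub A] at h
    rw [aux_inter_ost hκ hsub A hA]
    have hL := aux_inter_sub hsub hA
    rcases h with h | h
    · left
      rw [← not_nonempty_iff_eq_empty] at h ⊢
      rwa [aux_ost_nonempty hκ hL]
    · by_cases hne : (⋂ i ∈ A, F i).Nonempty
      · exact Or.inr (aux_main n hκ hL hne h)
      · left
        rw [← not_nonempty_iff_eq_empty, aux_ost_nonempty hκ hL]
        rintro ⟨x, s, hs, -⟩
        exact hne ⟨s, hs⟩
  · intro J
    rcases J.eq_empty_or_nonempty with hJ | hJ
    · subst hJ; simp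
    · dsimp only
      rw [aux_inter_subSpace hκ hsub J, aux_inter_ost hκ hsub J hJ]
      exact aux_ost_nonempty hκ (aux_inter_sub hsub hJ)
end

section
/- If 𝒰 is an open AE(n)-cover of a metric space Y, then any two 𝒰-close continuous maps from a metric space of dimension less than n into Y are 𝒰-homotopic. -/
open Set Metric unitInterval
open scoped ENNReal Classical

universe u
def SeqS : Set ℝ := insert 0 (range fun m : ℕ => 1 / ((m : ℝ) + 1))

abbrev Cub (n : ℕ) := Fin n → I

theorem covdim_homeo {X Y : Type*} [TopologicalSpace X] [TopologicalSpace Y] (e : X ≃ₜ Y)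
    {n : ℕ} (h : CovDimLT X n) : CovDimLT Y n := by
  intro U hU hc
  obtain ⟨R, hR, hRc, hRU, hRn⟩ := h ((fun u => e ⁻¹' u) '' U)
    (by rintro _ ⟨u, hu, rfl⟩; exact (hU u hu).preimage e.continuous)
    (by
      rw [eq_univ_iff_forall]; intro x
      have : e x ∈ ⋃₀ U := hc ▸ mem_univ _
      obtain ⟨u, hu, hx⟩ := this
      exact ⟨_, ⟨u, hu, rfl⟩, hx⟩)
  refine ⟨(fun r => e.symm ⁻¹' r) '' R, ?_, ?_, ?_, ?_⟩
  · rintro _ ⟨u, hu, rfl⟩; exact (hR u hu).preimage e.symm.continuous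
  · rw [eq_univ_iff_forall]; intro x
    have : e.symm x ∈ ⋃₀ R := hRc ▸ mem_univ _
    obtain ⟨u, hu, hx⟩ := this
    exact ⟨_, ⟨u, hu, rfl⟩, hx⟩
  · rintro _ ⟨r, hr, rfl⟩
    obtain ⟨_, ⟨u, hu, rfl⟩, hru⟩ := hRU r hr
    refine ⟨u, hu, fun y hy => ?_⟩
    have := hru hy
    simpa using this
  · intro y
    obtain ⟨h1, h2⟩ := hRn (e.symm y)
    have hsub : {r ∈ (fun r => e.symm ⁻¹' r) '' R | y ∈ r} ⊆
        (fun r => e.symm ⁻¹' r) '' {r ∈ R | e.symm y ∈ r} := by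
      rintro _ ⟨⟨r, hr, rfl⟩, hy⟩
      exact ⟨r, ⟨hr, hy⟩, rfl⟩
    refine ⟨(h1.image _).subset hsub, ?_⟩
    exact (ncard_le_ncard hsub (h1.image _)).trans ((ncard_image_le h1).trans h2)

theorem seqS_compact : IsCompact SeqS :=
  Filter.Tendsto.isCompact_insert_range tendsto_one_div_add_atTop_nhds_zero_nat

instance : CompactSpace SeqS := isCompact_iff_compactSpace.1 seqS_compact

theorem seqS_rat (x : SeqS) : ∃ q : ℚ, (q : ℝ) = x := by
  obtain ⟨x, rfl | ⟨m, rfl⟩⟩ := x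
  · exact ⟨0, by simp⟩
  · exact ⟨1 / ((m : ℚ) + 1), by push_cast; rfl⟩

theorem covdim_T (n : ℕ) : CovDimLE (SeqS × Cub n) n := by
  intro U hU hc
  obtain ⟨δ, hδ, hδU⟩ := lebesgue_number_lemma_of_metric_sUnion
    (isCompact_univ (X := SeqS × Cub n)) hU hc.ge
  obtain ⟨N, hN⟩ := exists_nat_one_div_lt hδ
  set M : ℝ := (N : ℝ) + 1 with hM
  have hMpos : 0 < M := by positivity
  have hsm : ∀ a b c : ℝ, c < M * a → M * a < c + 1 → c < M * b → M * b < c + 1 →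
      |a - b| < δ := by
    intro a b c h1 h2 h3 h4
    have h5 : M * |a - b| < 1 := by
      have h6 : M * |a - b| = |M * (a - b)| := by rw [abs_mul, abs_of_pos hMpos]
      rw [h6, abs_lt]
      constructor <;> nlinarith
    have : |a - b| < 1 / M := by
      rw [lt_div_iff₀ hMpos]; linarith
    linarith
  let pc : Fin (n + 1) → ℤ → (Fin n → ℤ) → Set (SeqS × Cub n) := fun i w z =>
    {p | (w + √2 < M * (p.1 : ℝ) ∧ M * (p.1 : ℝ) < w + √2 + 1) ∧
      ∀ k, (z k + (i : ℝ) / ((n : ℝ) + 1) < M * (p.2 k : ℝ) ∧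
        M * (p.2 k : ℝ) < z k + (i : ℝ) / ((n : ℝ) + 1) + 1)}
  have hfl : ∀ (a c : ℝ) (w : ℤ), w + c < a → a < w + c + 1 → w = ⌊a - c⌋ := by
    intro a c w h1 h2
    symm; rw [Int.floor_eq_iff]
    constructor <;> linarith
  refine ⟨{r | r.Nonempty ∧ ∃ i w z, r = pc i w z}, ?_, ?_, ?_, ?_⟩
  · rintro r ⟨-, i, w, z, rfl⟩
    have h1 : IsOpen {p : SeqS × Cub n | w + √2 < M * (p.1 : ℝ) ∧ M * (p.1 : ℝ) < w + √2 + 1} :=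
      (isOpen_lt (f := fun _ : SeqS × Cub n => w + √2) (by fun_prop) (by fun_prop)).and
        (isOpen_lt (f := fun p : SeqS × Cub n => M * (p.1 : ℝ)) (by fun_prop) (by fun_prop))
    have h2 : IsOpen {p : SeqS × Cub n | ∀ k, (z k + (i : ℝ) / ((n : ℝ) + 1) < M * (p.2 k : ℝ) ∧
        M * (p.2 k : ℝ) < z k + (i : ℝ) / ((n : ℝ) + 1) + 1)} := by
      rw [ofPred_forall]
      refine isOpen_iInter_of_finite fun k => ?_
      exact (isOpen_lt (f := fun _ : SeqS × Cub n => z k + (i : ℝ) / ((n : ℝ) + 1))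
        (by fun_prop) (by fun_prop)).and
        (isOpen_lt (f := fun p : SeqS × Cub n => M * (p.2 k : ℝ)) (by fun_prop) (by fun_prop))
    exact h1.and h2
  · rw [eq_univ_iff_forall]
    intro p
    have hi : ∃ i : Fin (n + 1), ∀ k, ∀ w : ℤ, (w : ℝ) ≠ M * (p.2 k : ℝ) - (i : ℝ) / ((n : ℝ) + 1) := by
      by_contra! hcon
      choose k w hw using hcon
      obtain ⟨i, j, hij, hk⟩ := Fintype.exists_ne_map_eq_of_card_lt k (by simp)
      have h1 := hw i
      have h2 := hw j
      rw [hk] at h1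
      have h3 : ((w i - w j : ℤ) : ℝ) * ((n : ℝ) + 1) = (j : ℝ) - (i : ℝ) := by
        push_cast
        rw [h1, h2]
        field_simp
        ring
      have h4 : (w i - w j) * ((n : ℤ) + 1) = (j : ℤ) - (i : ℤ) := by exact_mod_cast h3
      have hi := i.2
      have hj := j.2
      have hne : (i : ℕ) ≠ j := fun h => hij (Fin.ext h)
      rcases lt_trichotomy (w i - w j) 0 with h | h | h
      · nlinarith
      · rw [h] at h4; omega
      · nlinarith
    obtain ⟨i, hi⟩ := hi
    have hmem : p ∈ pc i ⌊M * (p.1 : ℝ) - √2⌋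
        (fun k => ⌊M * (p.2 k : ℝ) - (i : ℝ) / ((n : ℝ) + 1)⌋) := by
      refine ⟨⟨?_, ?_⟩, fun k => ⟨?_, ?_⟩⟩
      · have h1 := Int.floor_le (M * (p.1 : ℝ) - √2)
        rcases h1.lt_or_eq with h | h
        · linarith
        · exfalso
          obtain ⟨q, hq⟩ := seqS_rat p.1
          have : √2 = (((N : ℚ) + 1) * q - ⌊M * (p.1 : ℝ) - √2⌋ : ℚ) := by
            push_cast
            rw [hq]
            linarith
          exact irrational_sqrt_two ⟨_, this.symm⟩
      · have := Int.lt_floor_add_one (M * (p.1 : ℝ) - √2)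
        linarith
      · have h1 := Int.floor_le (M * (p.2 k : ℝ) - (i : ℝ) / ((n : ℝ) + 1))
        rcases h1.lt_or_eq with h | h
        · linarith
        · exact absurd h (hi k _)
      · have := Int.lt_floor_add_one (M * (p.2 k : ℝ) - (i : ℝ) / ((n : ℝ) + 1))
        linarith
    exact ⟨_, ⟨⟨p, hmem⟩, _, _, _, rfl⟩, hmem⟩
  · rintro r ⟨⟨p, hp⟩, i, w, z, rfl⟩
    obtain ⟨t, ht, hb⟩ := hδU p (mem_univ _)
    refine ⟨t, ht, fun q hq => hb ?_⟩
    rw [mem_ball, Prod.dist_eq, max_lt_iff]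
    constructor
    · rw [Subtype.dist_eq, Real.dist_eq]
      exact hsm _ _ _ hq.1.1 hq.1.2 hp.1.1 hp.1.2
    · rw [dist_pi_lt_iff hδ]
      intro k
      rw [Subtype.dist_eq, Real.dist_eq]
      exact hsm _ _ _ (hq.2 k).1 (hq.2 k).2 (hp.2 k).1 (hp.2 k).2
  · intro p
    let φ : Fin (n + 1) → Set (SeqS × Cub n) := fun i => pc i ⌊M * (p.1 : ℝ) - √2⌋
        (fun k => ⌊M * (p.2 k : ℝ) - (i : ℝ) / ((n : ℝ) + 1)⌋)
    have hsub : {r ∈ {r | r.Nonempty ∧ ∃ i w z, r = pc i w z} | p ∈ r} ⊆ φ '' univ := by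
      rintro r ⟨⟨-, i, w, z, rfl⟩, hp⟩
      refine ⟨i, mem_univ _, ?_⟩
      have h1 := hfl _ _ _ hp.1.1 hp.1.2
      have h2 : z = fun k => ⌊M * (p.2 k : ℝ) - (i : ℝ) / ((n : ℝ) + 1)⌋ := by
        funext k; exact hfl _ _ _ (hp.2 k).1 (hp.2 k).2
      simp only [φ]
      rw [← h1, ← h2]
    have hfin : (φ '' univ).Finite := (finite_univ).image _
    refine ⟨hfin.subset hsub, (ncard_le_ncard hsub hfin).trans ?_⟩
    refine (ncard_image_le finite_univ).trans ?_
    simp [ncard_univ]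

def CExt (n : ℕ) {P : Type*} [TopologicalSpace P] (V' V : Set P) : Prop :=
  ∀ B : Set (Cub n), IsClosed B → ∀ β : Cub n → P, ContinuousOn β B → MapsTo β B V' →
    ∃ γ : Cub n → P, Continuous γ ∧ EqOn γ β B ∧ ∀ q, γ q ∈ V

theorem ae_T {n : ℕ} {P : Type*} [TopologicalSpace P] {V : Set P} (h : IsAE.{u} n V)
    (A : Set (SeqS × Cub n)) (hA : IsClosed A) (β : SeqS × Cub n → P) (hβ : ContinuousOn β A)
    (hm : MapsTo β A V) : ∃ γ : SeqS × Cub n → P, Continuous γ ∧ EqOn γ β A ∧ ∀ q, γ q ∈ V := by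
  have hd : CovDimLE (ULift.{u} (SeqS × Cub n)) n :=
    covdim_homeo Homeomorph.ulift.symm (covdim_T n)
  have hcA : Continuous fun x : (ULift.down ⁻¹' A : Set (ULift.{u} (SeqS × Cub n))) =>
      β (ULift.down x.1) := by
    have h1 := continuousOn_iff_continuous_domRestrict.1 hβ
    exact h1.comp (Continuous.subtype_mk (f := fun x : (ULift.down ⁻¹' A : Set (ULift.{u} (SeqS × Cub n))) => ULift.down x.1)
      (continuous_uliftDown.comp continuous_subtype_val) (fun x => x.2))
  obtain ⟨g, hg⟩ := h (ULift.{u} (SeqS × Cub n)) hd (ULift.down ⁻¹' A)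
    (hA.preimage continuous_uliftDown)
    ⟨fun x => ⟨β (ULift.down x.1), hm x.2⟩, Continuous.subtype_mk hcA _⟩
  refine ⟨fun q => (g (ULift.up q) : P), ?_, ?_, fun q => (g _).2⟩
  · exact continuous_subtype_val.comp (g.continuous.comp continuous_uliftUp)
  · intro q hq
    have := hg ⟨ULift.up q, hq⟩
    simp only
    rw [this]
    rfl

theorem ae_ext {n : ℕ} {P : Type*} [TopologicalSpace P] {V : Set P} (h : IsAE.{u} n V) :
    CExt n V V := by
  intro B hB β hβ hm
  obtain ⟨γ, h1, h2, h3⟩ := ae_T h (Prod.snd ⁻¹' B) (hB.preimage continuous_snd)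
    (fun p => β p.2) (hβ.comp continuous_snd.continuousOn (fun _ h => h)) (fun p hp => hm hp)
  refine ⟨fun q => γ (⟨0, Or.inl rfl⟩, q), by fun_prop, ?_, fun q => h3 _⟩
  intro q hq
  exact h2 (x := (⟨0, Or.inl rfl⟩, q)) hq

theorem seqS_open (m : ℕ) : IsOpen {x : SeqS | (x : ℝ) = 1 / ((m : ℝ) + 1)} := by
  have : {x : SeqS | (x : ℝ) = 1 / ((m : ℝ) + 1)} =
      {x : SeqS | 1 < (x : ℝ) * ((m : ℝ) + 2)} ∩ {x : SeqS | (x : ℝ) * m < 1} := by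
    ext ⟨x, hx⟩
    simp only [mem_ofPred_eq, mem_inter_iff]
    constructor
    · rintro rfl
      constructor
      · rw [one_div, inv_mul_eq_div, lt_div_iff₀ (by positivity)]; linarith
      · rw [one_div, inv_mul_eq_div, div_lt_iff₀ (by positivity)]; linarith
    · rcases hx with rfl | ⟨k, rfl⟩
      · rintro ⟨h, -⟩; norm_num at h
      · rintro ⟨h1, h2⟩
        simp only at h1 h2
        rw [one_div, inv_mul_eq_div, lt_div_iff₀ (by positivity)] at h1
        rw [one_div, inv_mul_eq_div, div_lt_iff₀ (by positivity)] at h2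
        have h3 : k + 1 < m + 2 := by exact_mod_cast (by linarith : (k : ℝ) + 1 < m + 2)
        have h4 : m < k + 1 := by exact_mod_cast (by linarith : (m : ℝ) < k + 1)
        have : k = m := by omega
        rw [this]
  rw [this]
  exact (isOpen_lt (by fun_prop) (by fun_prop)).inter (isOpen_lt (by fun_prop) (by fun_prop))

theorem lc_of_ae {n : ℕ} {P : Type*} [MetricSpace P] {V : Set P} (h : IsAE.{u} n V)
    (y : P) (hy : y ∈ V) (O : Set P) (hO : IsOpen O) (hyO : y ∈ O) :
    ∃ ε > 0, CExt n (ball y ε ∩ V) O := by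
  by_contra! hcon
  have hm : ∀ m : ℕ, ¬ CExt n (ball y (1 / ((m : ℝ) + 1)) ∩ V) O := fun m =>
    hcon _ (by positivity)
  simp only [CExt, not_forall] at hm
  choose B hB β hβ hmaps hno using hm
  let idx : ℝ → ℕ := fun x => ⌊1 / x⌋₊ - 1
  have hidx : ∀ m : ℕ, idx (1 / ((m : ℝ) + 1)) = m := by
    intro m
    simp only [idx, one_div_one_div]
    have : ((m : ℝ) + 1) = ((m + 1 : ℕ) : ℝ) := by push_cast; rfl
    rw [this, Nat.floor_natCast]; simp
  let b : SeqS × Cub n → P := fun p => if (p.1 : ℝ) = 0 then y else β (idx p.1) p.2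
  let A : Set (SeqS × Cub n) := {p | (p.1 : ℝ) = 0 ∨ p.2 ∈ B (idx p.1)}
  have hne : ∀ m : ℕ, (1 / ((m : ℝ) + 1)) ≠ 0 := fun m => by positivity
  have hA : IsClosed A := by
    rw [← isOpen_compl_iff, isOpen_iff_mem_nhds]
    rintro ⟨⟨x, hx⟩, q⟩ hp
    rcases hx with rfl | ⟨m, rfl⟩
    · exact absurd (Or.inl rfl) hp
    · have hq : q ∉ B m := fun hq => hp (Or.inr (by simp only [hidx]; exact hq))
      have ho : IsOpen ({x : SeqS | (x : ℝ) = 1 / ((m : ℝ) + 1)} ×ˢ (B m)ᶜ) :=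
        (seqS_open m).prod (hB m).isOpen_compl
      refine Filter.mem_of_superset (ho.mem_nhds ⟨rfl, hq⟩) ?_
      rintro ⟨x', q'⟩ ⟨h1, h2⟩ h3
      simp only [mem_ofPred_eq] at h1
      rcases h3 with h3 | h3
      · exact hne m (h1 ▸ h3)
      · simp only [h1, hidx] at h3; exact h2 h3
  have hbA : ∀ p ∈ A, b p ∈ V ∧ dist (b p) y ≤ p.1 := by
    rintro ⟨⟨x, hx⟩, q⟩ hp
    rcases hx with rfl | ⟨m, rfl⟩
    · simp [b, hy]
    · rcases hp with hp | hp
      · exact absurd hp (hne m)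
      · simp only [hidx] at hp
        have := hmaps m hp
        simp only [b, hidx, if_neg (hne m)]
        exact ⟨this.2, this.1.le⟩
  have hbc : ContinuousOn b A := by
    rintro ⟨⟨x, hx⟩, q⟩ hp
    rcases hx with rfl | ⟨m, rfl⟩
    · have hb0 : b (⟨0, Or.inl rfl⟩, q) = y := by simp [b]
      rw [ContinuousWithinAt, hb0, tendsto_iff_dist_tendsto_zero]
      refine squeeze_zero' (g := fun p : SeqS × Cub n => (p.1 : ℝ)) (Filter.Eventually.of_forall fun _ => dist_nonneg) ?_ ?_
      · filter_upwards [self_mem_nhdsWithin] with p hp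
        exact (hbA p hp).2
      · have : Continuous fun p : SeqS × Cub n => (p.1 : ℝ) := by fun_prop
        exact (this.tendsto (⟨0, Or.inl rfl⟩, q)).mono_left nhdsWithin_le_nhds
    · rcases hp with hp | hp
      · exact absurd hp (hne m)
      simp only [hidx] at hp
      have ho : IsOpen (Prod.fst ⁻¹' {x : SeqS | (x : ℝ) = 1 / ((m : ℝ) + 1)} :
          Set (SeqS × Cub n)) := (seqS_open m).preimage continuous_fst
      have h1 : ContinuousWithinAt (fun p : SeqS × Cub n => β m p.2)
          (A ∩ Prod.fst ⁻¹' {x : SeqS | (x : ℝ) = 1 / ((m : ℝ) + 1)})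
          (⟨1 / ((m : ℝ) + 1), Or.inr ⟨m, rfl⟩⟩, q) := by
        refine ContinuousWithinAt.comp (t := B m) (hβ m q hp) continuous_snd.continuousWithinAt ?_
        rintro ⟨x', q'⟩ ⟨h1, h2⟩
        simp only [mem_preimage, mem_ofPred_eq] at h2
        rcases h1 with h3 | h3
        · exact absurd (h2 ▸ h3) (hne m)
        · simp only [h2, hidx] at h3; exact h3
      rw [← continuousWithinAt_inter (ho.mem_nhds rfl)]
      refine h1.congr ?_ ?_
      · rintro ⟨x', q'⟩ ⟨h1, h2⟩
        simp only [mem_preimage, mem_ofPred_eq] at h2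
        simp only [b, h2, hidx, if_neg (hne m)]
      · simp only [b, hidx, if_neg (hne m)]
  obtain ⟨γ, hγ, hγe, hγV⟩ := ae_T h A hA b hbc (fun p hp => (hbA p hp).1)
  -- tube
  have h0 : ∀ q, γ (⟨0, Or.inl rfl⟩, q) = y := by
    intro q
    rw [hγe (Or.inl rfl)]
    simp [b]
  have htube : ∀ᶠ x : SeqS in nhds ⟨0, Or.inl rfl⟩, ∀ q : Cub n, γ (x, q) ∈ O := by
    have : ∀ᶠ x : SeqS in nhds ⟨0, Or.inl rfl⟩, ∀ q ∈ (univ : Set (Cub n)), γ (x, q) ∈ O := by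
      refine isCompact_univ.eventually_forall_of_forall_eventually ?_
      intro q _
      refine hγ.continuousAt.eventually_mem (hO.mem_nhds ?_)
      rw [h0]; exact hyO
    simpa using this
  have hconv : Filter.Tendsto (fun m : ℕ => (⟨1 / ((m : ℝ) + 1), Or.inr ⟨m, rfl⟩⟩ : SeqS))
      Filter.atTop (nhds ⟨0, Or.inl rfl⟩) := by
    rw [tendsto_subtype_rng]
    exact tendsto_one_div_add_atTop_nhds_zero_nat
  obtain ⟨m, hm⟩ := (hconv.eventually htube).exists
  refine hno m ⟨fun q => γ (⟨1 / ((m : ℝ) + 1), Or.inr ⟨m, rfl⟩⟩, q), by fun_prop, ?_, hm⟩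
  intro q hq
  simp only
  rw [hγe (Or.inr (by simp only [hidx]; exact hq))]
  simp only [b, hidx, if_neg (hne m)]

theorem ext_cell {n : ℕ} {P M : Type*} [TopologicalSpace P] [TopologicalSpace M] [T2Space M]
    {V' V : Set P} (h : CExt n V' V) {B c : Set M} (hB : IsCompact B) (hBc : B ⊆ c)
    (e : M → Cub n) (he : ContinuousOn e c) (hinj : InjOn e c) (β : M → P)
    (hβ : ContinuousOn β B) (hm : MapsTo β B V') :
    ∃ γ : M → P, ContinuousOn γ c ∧ EqOn γ β B ∧ ∀ q, γ q ∈ V := by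
  rcases isEmpty_or_nonempty M with hM | hM
  · exact ⟨β, by rw [eq_empty_of_isEmpty c]; exact continuousOn_empty _, fun _ _ => rfl,
      fun q => hM.elim q⟩
  have hinv : ∀ x ∈ B, Function.invFunOn e B (e x) = x := fun x hx =>
    (hinj.mono hBc).leftInvOn_invFunOn hx
  obtain ⟨γ, h1, h2, h3⟩ := h (e '' B) (hB.image_of_continuousOn (he.mono hBc)).isClosed
    (β ∘ Function.invFunOn e B) (by
      rw [continuousOn_iff_isClosed]
      intro t ht
      refine ⟨e '' (B ∩ β ⁻¹' t), ?_, ?_⟩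
      · have : IsCompact (B ∩ β ⁻¹' t) :=
          hB.of_isClosed_subset (hβ.preimage_isClosed_of_isClosed hB.isClosed ht) inter_subset_left
        exact (this.image_of_continuousOn (he.mono (inter_subset_left.trans hBc))).isClosed
      · ext q
        constructor
        · rintro ⟨hq, x, hx, rfl⟩
          simp only [mem_preimage, Function.comp, hinv x hx] at hq
          exact ⟨⟨x, ⟨hx, hq⟩, rfl⟩, x, hx, rfl⟩
        · rintro ⟨⟨x, ⟨hx, hq⟩, rfl⟩, -⟩
          refine ⟨?_, x, hx, rfl⟩
          simp only [mem_preimage, Function.comp, hinv x hx]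
          exact hq)
    (by rintro _ ⟨x, hx, rfl⟩; simp only [Function.comp, hinv x hx]; exact hm hx)
  refine ⟨γ ∘ e, h1.comp_continuousOn he, ?_, fun q => h3 _⟩
  intro x hx
  simp only [Function.comp]
  rw [h2 ⟨x, hx, rfl⟩]
  simp only [Function.comp, hinv x hx]
def OCov {P : Type*} [TopologicalSpace P] (C : Set (Set P)) : Prop :=
  (∀ V ∈ C, IsOpen V) ∧ ∀ y, ∃ V ∈ C, y ∈ V

theorem star_ref {P : Type*} [MetricSpace P] {C : Set (Set P)} (h : OCov C) :
    ∃ D : Set (Set P), OCov D ∧ ∀ y, ∃ V ∈ C, ∀ W ∈ D, y ∈ W → W ⊆ V := by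
  have h1 : ∀ y, ∃ V ∈ C, ∃ ε : ℝ, 0 < ε ∧ ε ≤ 1 ∧ ball y ε ⊆ V := by
    intro y
    obtain ⟨V, hV, hy⟩ := h.2 y
    obtain ⟨ε, hε, hb⟩ := Metric.isOpen_iff.1 (h.1 V hV) y hy
    exact ⟨V, hV, min ε 1, lt_min hε one_pos, min_le_right _ _,
      (ball_subset_ball (min_le_left _ _)).trans hb⟩
  choose V hV ε hε hε1 hb using h1
  refine ⟨range fun y => ball y (ε y / 8), ⟨?_, fun y => ⟨_, ⟨y, rfl⟩, ?_⟩⟩, ?_⟩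
  · rintro _ ⟨y, rfl⟩; exact isOpen_ball
  · exact mem_ball_self (by have := hε y; positivity)
  · intro y
    let S : Set ℝ := ε '' {z | y ∈ ball z (ε z / 8)}
    have hbdd : BddAbove S := ⟨1, by rintro _ ⟨z, -, rfl⟩; exact hε1 z⟩
    have hyS : ε y ∈ S := ⟨y, mem_ball_self (by have := hε y; positivity), rfl⟩
    have hpos : 0 < sSup S := (hε y).trans_le (le_csSup hbdd hyS)
    obtain ⟨_, ⟨z, hz, rfl⟩, hlt⟩ := exists_lt_of_lt_csSup ⟨_, hyS⟩ (half_lt_self hpos)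
    refine ⟨V z, hV z, ?_⟩
    rintro _ ⟨w, rfl⟩ hyw
    have hw : ε w ≤ sSup S := le_csSup hbdd ⟨w, hyw, rfl⟩
    refine Subset.trans ?_ (hb z)
    intro q hq
    rw [mem_ball] at *
    simp only [mem_ball, mem_ofPred_eq] at hz hyw
    have t1 := dist_triangle q w z
    have t2 := dist_triangle w y z
    rw [dist_comm w y] at t2
    linarith

def LCn (n : ℕ) (P : Type*) [TopologicalSpace P] : Prop :=
  ∀ y : P, ∀ O, IsOpen O → y ∈ O → ∃ V', IsOpen V' ∧ y ∈ V' ∧ V' ⊆ O ∧ CExt n V' O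

theorem lc_ref {n : ℕ} {P : Type*} [MetricSpace P] (hL : LCn n P) {C : Set (Set P)}
    (h : OCov C) : ∃ D : Set (Set P), OCov D ∧ ∀ y, ∃ V ∈ C, ∃ V' ⊆ V, CExt n V' V ∧
      ∀ W ∈ D, y ∈ W → W ⊆ V' := by
  have h1 : ∀ y, ∃ V ∈ C, ∃ V' ⊆ V, IsOpen V' ∧ y ∈ V' ∧ CExt n V' V := by
    intro y
    obtain ⟨V, hV, hy⟩ := h.2 y
    obtain ⟨V', h1, h2, h3, h4⟩ := hL y V (h.1 V hV) hy
    exact ⟨V, hV, V', h3, h1, h2, h4⟩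
  choose V hV V' hVV ho hy hext using h1
  obtain ⟨D, hD, hs⟩ := star_ref (C := range V') ⟨by rintro _ ⟨y, rfl⟩; exact ho y,
    fun y => ⟨_, ⟨y, rfl⟩, hy y⟩⟩
  refine ⟨D, hD, fun y => ?_⟩
  obtain ⟨_, ⟨z, rfl⟩, hz⟩ := hs y
  exact ⟨V z, hV z, V' z, hVV z, hext z, hz⟩

theorem cell_ext {α M P : Type*} [TopologicalSpace M] [T2Space M] [TopologicalSpace P] {n : ℕ}
    (K : Set (Finset α)) (hKne : ∀ s ∈ K, s.Nonempty)
    (hKd : ∀ s ∈ K, ∀ t ⊆ s, t.Nonempty → t ∈ K) (hKn : ∀ s ∈ K, s.card ≤ n)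
    (c : Finset α → Set M) (hc0 : c ∅ = ∅) (hcI : ∀ s t, c s ∩ c t ⊆ c (s ∩ t))
    (hcm : ∀ s t, s ⊆ t → c s ⊆ c t) (hcc : ∀ s ∈ K, IsCompact (c s))
    (hce : ∀ s ∈ K, ∃ e : M → Cub n, ContinuousOn e (c s) ∧ InjOn e (c s))
    (L : Set M) (hL : IsClosed L) (φ0 : M → P) (hφ0 : ∀ s ∈ K, ContinuousOn φ0 (L ∩ c s))
    (Good : Finset α → Set P → Prop)
    (hstep : ∀ s ∈ K, ∀ φ : M → P, (∀ t, t ⊂ s → t ∈ K → Good t (φ '' c t)) →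
      ∃ V' V, CExt n V' V ∧ φ0 '' (L ∩ c s) ⊆ V' ∧ (∀ t, t ⊂ s → t ∈ K → φ '' c t ⊆ V') ∧
        ∀ S ⊆ V, Good s S) :
    ∃ φ : M → P, ∀ s ∈ K, ContinuousOn φ (c s) ∧ EqOn φ φ0 (L ∩ c s) ∧ Good s (φ '' c s) := by
  suffices H : ∀ k : ℕ, ∃ φ : M → P, ∀ s ∈ K, s.card ≤ k →
      ContinuousOn φ (c s) ∧ EqOn φ φ0 (L ∩ c s) ∧ Good s (φ '' c s) by
    obtain ⟨φ, hφ⟩ := H n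
    exact ⟨φ, fun s hs => hφ s hs (hKn s hs)⟩
  intro k
  induction k with
  | zero =>
    refine ⟨φ0, fun s hs h => ?_⟩
    have := Finset.card_pos.2 (hKne s hs)
    omega
  | succ k ih =>
    obtain ⟨φ, hφ⟩ := ih
    have hlow : ∀ s ∈ K, s.card = k + 1 → ∀ t, t ⊂ s → t.card ≤ k := by
      intro s _ hsc t ht
      have := Finset.card_lt_card ht
      omega
    have hγ : ∀ s ∈ K, s.card = k + 1 → ∃ γ : M → P, ContinuousOn γ (c s) ∧
        EqOn γ φ0 (L ∩ c s) ∧ (∀ t, t ⊂ s → t ∈ K → EqOn γ φ (c t)) ∧ Good s (γ '' c s) := by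
      intro s hs hsc
      obtain ⟨V', V, hext, hVL, hVt, hG⟩ := hstep s hs φ
        (fun t hts htK => (hφ t htK (hlow s hs hsc t hts)).2.2)
      obtain ⟨e, he, hinj⟩ := hce s hs
      let τ := {t : Finset α // t ⊂ s ∧ t ∈ K}
      have : Finite τ := by
        refine Finite.of_injective (fun t : τ => (⟨t.1, Finset.mem_powerset.2 t.2.1.subset⟩ :
          {x // x ∈ s.powerset})) ?_
        intro a b hab
        exact Subtype.ext (by simpa using hab)
      let β : M → P := fun p => if p ∈ L then φ0 p else φ p
      have hβL : EqOn β φ0 (L ∩ c s) := fun p hp => by simp [β, hp.1]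
      have hβt : ∀ t : τ, EqOn β φ (c t.1) := by
        intro t p hp
        by_cases hpL : p ∈ L
        · simp only [β, if_pos hpL]
          exact ((hφ t.1 t.2.2 (hlow s hs hsc t.1 t.2.1)).2.1 ⟨hpL, hp⟩).symm
        · simp only [β, if_neg hpL]
      have hct : ∀ t : τ, IsCompact (c t.1) := fun t => hcc _ t.2.2
      obtain ⟨γ, hγ1, hγ2, hγ3⟩ := ext_cell (B := (L ∩ c s) ∪ ⋃ t : τ, c t.1) (c := c s) hext
        (((hcc s hs).inter_left hL).union (isCompact_iUnion hct))
        (union_subset inter_subset_right (iUnion_subset fun t => hcm _ _ t.2.1.subset))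
        e he hinj β
        (by
          refine ContinuousOn.union_of_isClosed ((hφ0 s hs).congr hβL) ?_
            (hL.inter (hcc s hs).isClosed) (isCompact_iUnion hct).isClosed
          refine (locallyFinite_of_finite _).continuousOn_iUnion (fun t => (hct t).isClosed)
            (fun t => ?_)
          exact (hφ t.1 t.2.2 (hlow s hs hsc t.1 t.2.1)).1.congr (hβt t))
        (by
          rintro p (hp | hp)
          · rw [hβL hp]; exact hVL ⟨p, hp, rfl⟩
          · obtain ⟨t, ht⟩ := mem_iUnion.1 hp
            rw [hβt t ht]; exact hVt t.1 t.2.1 t.2.2 ⟨p, ht, rfl⟩)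
      refine ⟨γ, hγ1, ?_, ?_, hG _ ?_⟩
      · intro p hp
        rw [hγ2 (Or.inl hp), hβL hp]
      · intro t hts htK p hp
        rw [hγ2 (Or.inr (mem_iUnion.2 ⟨⟨t, hts, htK⟩, hp⟩)), hβt ⟨t, hts, htK⟩ hp]
      · rintro _ ⟨p, -, rfl⟩; exact hγ3 p
    have hγ' : ∀ s, ∃ γ : M → P, s ∈ K → s.card = k + 1 → ContinuousOn γ (c s) ∧
        EqOn γ φ0 (L ∩ c s) ∧ (∀ t, t ⊂ s → t ∈ K → EqOn γ φ (c t)) ∧ Good s (γ '' c s) := by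
      intro s
      by_cases h : s ∈ K ∧ s.card = k + 1
      · obtain ⟨γ, h1⟩ := hγ s h.1 h.2
        exact ⟨γ, fun _ _ => h1⟩
      · exact ⟨φ0, fun a b => absurd ⟨a, b⟩ h⟩
    choose γ hγ' using hγ'
    have hγ1 := fun s hs hc => (hγ' s hs hc).1
    have hγ2 := fun s hs hc => (hγ' s hs hc).2.1
    have hγ3 := fun s hs hc => (hγ' s hs hc).2.2.1
    have hγ4 := fun s hs hc => (hγ' s hs hc).2.2.2
    let ψ : M → P := fun p => if ∃ s ∈ K, s.card ≤ k ∧ p ∈ c s then φ p else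
      if h : ∃ s ∈ K, s.card = k + 1 ∧ p ∈ c s then γ h.choose p else φ0 p
    have hψ1 : ∀ s ∈ K, s.card ≤ k → EqOn ψ φ (c s) := by
      intro s hs hsc p hp
      simp only [ψ]
      rw [if_pos ⟨s, hs, hsc, hp⟩]
    have hint : ∀ s ∈ K, ∀ t, ∀ p ∈ c s, p ∈ c t → ¬ s ⊆ t → s ∩ t ⊂ s ∧ s ∩ t ∈ K ∧ p ∈ c (s ∩ t) := by
      intro s hs t p hp hpt hst
      have h1 := hcI s t ⟨hp, hpt⟩
      have h2 : (s ∩ t).Nonempty := by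
        by_contra h
        rw [Finset.not_nonempty_iff_eq_empty] at h
        rw [h, hc0] at h1
        exact h1
      refine ⟨⟨Finset.inter_subset_left, fun h => hst (h.trans Finset.inter_subset_right)⟩,
        hKd s hs _ Finset.inter_subset_left h2, h1⟩
    have hψ2 : ∀ s ∈ K, s.card = k + 1 → EqOn ψ (γ s) (c s) := by
      intro s hs hsc p hp
      simp only [ψ]
      split_ifs with h1 h2
      · obtain ⟨t, ht, htc, hpt⟩ := h1
        have hst : ¬ s ⊆ t := fun h => by have := Finset.card_le_card h; omega
        obtain ⟨a, b, d⟩ := hint s hs t p hp hpt hst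
        exact (hγ3 s hs hsc _ a b d).symm
      · obtain ⟨ht, htc, hpt⟩ := h2.choose_spec
        by_cases hst : s ⊆ h2.choose
        · rw [← Finset.eq_of_subset_of_card_le hst (by omega)]
        · obtain ⟨a, b, d⟩ := hint s hs _ p hp hpt hst
          exact absurd ⟨_, b, hlow s hs hsc _ a, d⟩ h1
      · exact absurd ⟨s, hs, hsc, hp⟩ h2
    refine ⟨ψ, fun s hs hsc => ?_⟩
    rcases Nat.lt_or_ge s.card (k + 1) with h | h
    · have h' : s.card ≤ k := by omega
      obtain ⟨a, b, d⟩ := hφ s hs h'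
      have he := hψ1 s hs h'
      refine ⟨a.congr he, fun p hp => ?_, ?_⟩
      · rw [he hp.2, b hp]
      · rw [he.image_eq]; exact d
    · have h' : s.card = k + 1 := by omega
      have he := hψ2 s hs h'
      refine ⟨(hγ1 s hs h').congr he, fun p hp => ?_, ?_⟩
      · rw [he hp.2, hγ2 s hs h' hp]
      · rw [he.image_eq]; exact hγ4 s hs h'
def Dl {α : Type*} (s : Finset α) : Set (α → ℝ) :=
  {p | (∀ a, 0 ≤ p a) ∧ (∀ a, a ∉ s → p a = 0) ∧ ∑ a ∈ s, p a = 1}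

def Pr {α : Type*} (s : Finset α) : Set ((α → ℝ) × ℝ) := Dl s ×ˢ Icc 0 1

theorem Dl_of_supp {α : Type*} {s s' : Finset α} {p : α → ℝ} (h : p ∈ Dl s')
    (hs : ∀ a, p a ≠ 0 → a ∈ s) : p ∈ Dl s := by
  refine ⟨h.1, fun a ha => by_contra fun h' => ha (hs a h'), ?_⟩
  have h1 : ∑ a ∈ s, p a = ∑ a ∈ s ∪ s', p a :=
    Finset.sum_subset Finset.subset_union_left
      (fun a _ ha => by_contra fun h' => ha (hs a h'))
  have h2 : ∑ a ∈ s', p a = ∑ a ∈ s ∪ s', p a :=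
    Finset.sum_subset Finset.subset_union_right (fun a _ ha => h.2.1 a ha)
  rw [h1, ← h2, h.2.2]

theorem Dl_supp {α : Type*} {s : Finset α} {p : α → ℝ} (h : p ∈ Dl s) {a : α} (ha : p a ≠ 0) :
    a ∈ s := by_contra fun h' => ha (h.2.1 a h')

theorem Dl_mono {α : Type*} {s t : Finset α} (h : s ⊆ t) : Dl s ⊆ Dl t := fun _ hp =>
  Dl_of_supp hp fun _ ha => h (Dl_supp hp ha)

theorem Dl_inter {α : Type*} (s t : Finset α) : Dl s ∩ Dl t ⊆ Dl (s ∩ t) := fun _ hp =>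
  Dl_of_supp hp.1 fun _ ha => Finset.mem_inter.2 ⟨Dl_supp hp.1 ha, Dl_supp hp.2 ha⟩

theorem Dl_empty {α : Type*} : Dl (∅ : Finset α) = ∅ := by
  ext p; simp [Dl]

theorem Dl_le {α : Type*} {s : Finset α} {p : α → ℝ} (h : p ∈ Dl s) (a : α) : p a ≤ 1 := by
  by_cases ha : a ∈ s
  · rw [← h.2.2]; exact Finset.single_le_sum (fun i _ => h.1 i) ha
  · rw [h.2.1 a ha]; exact zero_le_one

theorem Dl_compact {α : Type*} (s : Finset α) : IsCompact (Dl s) := by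
  refine (isCompact_univ_pi (s := fun _ : α => Icc (0 : ℝ) 1) fun _ => isCompact_Icc).of_isClosed_subset
    ?_ ?_
  · have h1 : IsClosed {p : α → ℝ | ∀ a, 0 ≤ p a} := by
      rw [ofPred_forall]
      exact isClosed_iInter fun a => isClosed_le continuous_const (continuous_apply a)
    have h2 : IsClosed {p : α → ℝ | ∀ a, a ∉ s → p a = 0} := by
      simp only [ofPred_forall]
      exact isClosed_iInter fun a => isClosed_iInter fun _ =>
        isClosed_eq (continuous_apply a) continuous_const
    have h3 : IsClosed {p : α → ℝ | ∑ a ∈ s, p a = 1} :=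
      isClosed_eq (by fun_prop) continuous_const
    exact h1.inter (h2.inter h3)
  · intro p hp a _
    exact ⟨hp.1 a, Dl_le hp a⟩

theorem Pr_embed {α : Type*} {n : ℕ} (s : Finset α) (hs : s.Nonempty) (hn : s.card ≤ n) :
    ∃ e : (α → ℝ) × ℝ → Cub n, ContinuousOn e (Pr s) ∧ InjOn e (Pr s) := by
  obtain ⟨m⟩ : Nonempty (s ↪ Fin n) := by
    apply Function.Embedding.nonempty_of_card_le
    simpa using hn
  obtain ⟨a0, ha0⟩ := hs
  have : Nonempty s := ⟨⟨a0, ha0⟩⟩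
  let e : (α → ℝ) × ℝ → Cub n := fun q i =>
    if i = m ⟨a0, ha0⟩ then projIcc (0 : ℝ) 1 zero_le_one q.2
    else projIcc (0 : ℝ) 1 zero_le_one (q.1 ((Function.invFun (m : s → Fin n) i : s) : α))
  refine ⟨e, Continuous.continuousOn (continuous_pi fun i => ?_), ?_⟩
  · by_cases h : i = m ⟨a0, ha0⟩
    · simp only [e, h, if_true]
      exact continuous_projIcc.comp continuous_snd
    · simp only [e, if_neg h]
      exact continuous_projIcc.comp ((continuous_apply _).comp continuous_fst)
  · rintro ⟨p, t⟩ ⟨hp, ht⟩ ⟨p', t'⟩ ⟨hp', ht'⟩ heq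
    simp only at hp hp' ht ht'
    have h1 : t = t' := by
      have := congrFun heq (m ⟨a0, ha0⟩)
      simp only [e, if_true] at this
      exact (strictMonoOn_projIcc _).injOn ht ht' this
    have h2 : ∀ a ∈ s, a ≠ a0 → p a = p' a := by
      intro a ha hne
      have := congrFun heq (m ⟨a, ha⟩)
      have hne' : m ⟨a, ha⟩ ≠ m ⟨a0, ha0⟩ := fun h => hne (by simpa using m.injective h)
      simp only [e, if_neg hne', Function.leftInverse_invFun m.injective _] at this
      exact (strictMonoOn_projIcc _).injOn ⟨hp.1 a, Dl_le hp a⟩ ⟨hp'.1 a, Dl_le hp' a⟩ this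
    have h3 : p a0 = p' a0 := by
      have e1 := hp.2.2
      have e2 := hp'.2.2
      rw [← Finset.add_sum_erase _ _ ha0] at e1 e2
      have : ∑ x ∈ s.erase a0, p x = ∑ x ∈ s.erase a0, p' x :=
        Finset.sum_congr rfl fun a ha => h2 a (Finset.mem_of_mem_erase ha) (Finset.ne_of_mem_erase ha)
      linarith
    refine Prod.ext ?_ h1
    funext a
    by_cases ha : a ∈ s
    · by_cases h : a = a0
      · rw [h]; exact h3
      · exact h2 a ha h
    · exact (hp.2.1 a ha).trans (hp'.2.1 a ha).symm

def Qs {X : Type*} (s : Finset (Set X)) : Set X := {x | ∀ a ∈ s, x ∈ a}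

def Nv {X : Type*} (R : Set (Set X)) : Set (Finset (Set X)) :=
  {s | s.Nonempty ∧ (∀ a ∈ s, a ∈ R) ∧ (Qs s).Nonempty}

def Ordn {X : Type*} (n : ℕ) (R : Set (Set X)) : Prop :=
  ∀ x, {r ∈ R | x ∈ r}.Finite ∧ {r ∈ R | x ∈ r}.ncard ≤ n

theorem Nv_down {X : Type*} {R : Set (Set X)} (s) (hs : s ∈ Nv R) (t) (hts : t ⊆ s)
    (ht : t.Nonempty) : t ∈ Nv R := by
  obtain ⟨-, h1, x, hx⟩ := hs
  exact ⟨ht, fun a ha => h1 a (hts ha), x, fun a ha => hx a (hts ha)⟩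

theorem Nv_card {X : Type*} {R : Set (Set X)} {n : ℕ} (hR : Ordn n R) (s) (hs : s ∈ Nv R) :
    s.card ≤ n := by
  obtain ⟨-, h1, x, hx⟩ := hs
  rw [← ncard_coe_finset]
  have hsub : (↑s : Set (Set X)) ⊆ {r ∈ R | x ∈ r} := fun a ha => ⟨h1 a ha, hx a ha⟩
  exact (ncard_le_ncard hsub (hR x).1).trans (hR x).2

theorem prism_ext {X P : Type*} [TopologicalSpace P] {n : ℕ} {R : Set (Set X)} (hR : Ordn n R)
    (L : Set ((Set X → ℝ) × ℝ)) (hL : IsClosed L) (φ0 : (Set X → ℝ) × ℝ → P)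
    (hφ0 : ∀ s ∈ Nv R, ContinuousOn φ0 (L ∩ Pr s))
    (Good : Finset (Set X) → Set P → Prop)
    (hstep : ∀ s ∈ Nv R, ∀ φ : (Set X → ℝ) × ℝ → P,
      (∀ t, t ⊂ s → t ∈ Nv R → Good t (φ '' Pr t)) →
      ∃ V' V, CExt n V' V ∧ φ0 '' (L ∩ Pr s) ⊆ V' ∧
        (∀ t, t ⊂ s → t ∈ Nv R → φ '' Pr t ⊆ V') ∧ ∀ S ⊆ V, Good s S) :
    ∃ φ : (Set X → ℝ) × ℝ → P, ∀ s ∈ Nv R,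
      ContinuousOn φ (Pr s) ∧ EqOn φ φ0 (L ∩ Pr s) ∧ Good s (φ '' Pr s) := by
  refine cell_ext (n := n) (Nv R) (fun s hs => hs.1) Nv_down (Nv_card hR) Pr ?_ ?_ ?_ ?_ ?_ L hL φ0 hφ0
    Good hstep
  · simp [Pr, Dl_empty]
  · rintro s t ⟨p, r⟩ ⟨⟨h1, h2⟩, ⟨h3, -⟩⟩
    exact ⟨Dl_inter s t ⟨h1, h3⟩, h2⟩
  · intro s t hst
    exact prod_mono (Dl_mono hst) Subset.rfl
  · intro s _
    exact (Dl_compact s).prod isCompact_Icc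
  · intro s hs
    exact Pr_embed s hs.1 (Nv_card hR s hs)

theorem cover_prism {X P : Type*} [MetricSpace P] {n : ℕ} (hLC : LCn n P) (F : X → P)
    {C : Set (Set P)} (hC : OCov C) : ∃ C' : Set (Set P), OCov C' ∧ 
    ∀ R : Set (Set X), Ordn n R → 
    ∀ (L : Set ((Set X → ℝ) × ℝ)) (_ : IsClosed L) (φ0 : (Set X → ℝ) × ℝ → P)
    (_ : ∀ s ∈ Nv R, ContinuousOn φ0 (L ∩ Pr s))
    (_ : ∀ s ∈ Nv R, ∃ V ∈ C', φ0 '' (L ∩ Pr s) ⊆ V ∧ F '' Qs s ⊆ V),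
    ∃ φ : (Set X → ℝ) × ℝ → P, ∀ s ∈ Nv R,
      ContinuousOn φ (Pr s) ∧ EqOn φ φ0 (L ∩ Pr s) ∧
        ∃ V ∈ C, φ '' Pr s ⊆ V ∧ F '' Qs s ⊆ V := by
  have hst : ∀ D : {D : Set (Set P) // OCov D}, ∃ E : {D : Set (Set P) // OCov D},
      ∀ y, ∃ V ∈ D.1, ∃ V' ⊆ V, CExt n V' V ∧ ∀ W ∈ E.1, y ∈ W → W ⊆ V' := by
    rintro ⟨D, hD⟩
    obtain ⟨E, hE, h⟩ := lc_ref hLC hD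
    exact ⟨⟨E, hE⟩, h⟩
  choose st hst using hst
  let W : ℕ → {D : Set (Set P) // OCov D} := fun j => Nat.rec ⟨C, hC⟩ (fun _ D => st D) j
  have hW : ∀ j y, ∃ V ∈ (W j).1, ∃ V' ⊆ V, CExt n V' V ∧
      ∀ U ∈ (W (j + 1)).1, y ∈ U → U ⊆ V' := fun j y => hst (W j) y
  have hW0 : (W 0).1 = C := rfl
  have href : ∀ j d y, ∀ U ∈ (W (j + d)).1, y ∈ U → ∃ V ∈ (W j).1, U ⊆ V := by
    intro j d y
    induction d with
    | zero => exact fun U hU _ => ⟨U, hU, Subset.rfl⟩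
    | succ d ih =>
      intro U hU hy
      obtain ⟨V, hV, V', hVV, -, h⟩ := hW (j + d) y
      have h1 := (h U hU hy).trans hVV
      obtain ⟨V2, h2, h3⟩ := ih V hV (h1 hy)
      exact ⟨V2, h2, h1.trans h3⟩
  have href' : ∀ j k, j ≤ k → ∀ y, ∀ U ∈ (W k).1, y ∈ U → ∃ V ∈ (W j).1, U ⊆ V := by
    intro j k hjk y
    obtain ⟨d, rfl⟩ := Nat.exists_eq_add_of_le hjk
    exact href j d y
  refine ⟨(W n).1, (W n).2, ?_⟩
  intro R hR L hL φ0 hφ0 hH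
  obtain ⟨φ, hφ⟩ := prism_ext hR L hL φ0 hφ0
    (fun s S => ∃ V ∈ (W (n - s.card)).1, S ⊆ V ∧ F '' Qs s ⊆ V) (by
      intro s hs φ hG
      obtain ⟨x, hx⟩ := hs.2.2
      have hc := Nv_card hR s hs
      have hpos := Finset.card_pos.2 hs.1
      obtain ⟨V, hV, V', hVV, hext, hst⟩ := hW (n - s.card) (F x)
      obtain ⟨V0, hV0, hV01, hV02⟩ := hH s hs
      have hV0' : V0 ⊆ V' := by
        have hy : F x ∈ V0 := hV02 ⟨x, hx, rfl⟩
        obtain ⟨V1, h1, h2⟩ := href' (n - s.card + 1) n (by omega) (F x) V0 hV0 hy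
        exact h2.trans (hst V1 h1 (h2 hy))
      refine ⟨V', V, hext, hV01.trans hV0', ?_, fun S hS => ⟨V, hV, hS, hV02.trans (hV0'.trans hVV)⟩⟩
      intro t hts htK
      obtain ⟨Vt, hVt, h1, h2⟩ := hG t hts htK
      have hlt := Finset.card_lt_card hts
      have hy : F x ∈ Vt := h2 ⟨x, fun a ha => hx a (hts.subset ha), rfl⟩
      obtain ⟨V1, h3, h4⟩ := href' (n - s.card + 1) (n - t.card) (by omega) (F x) Vt hVt hy
      exact h1.trans (h4.trans (hst V1 h3 (h4 hy))))
  refine ⟨φ, fun s hs => ⟨(hφ s hs).1, (hφ s hs).2.1, ?_⟩⟩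
  obtain ⟨V, hV, h1, h2⟩ := (hφ s hs).2.2
  obtain ⟨x, hx⟩ := hs.2.2
  obtain ⟨V2, h3, h4⟩ := href' 0 _ (Nat.zero_le _) (F x) V hV (h2 ⟨x, hx, rfl⟩)
  exact ⟨V2, h3, h1.trans h4, h2.trans h4⟩

theorem glue {T P α : Type*} [TopologicalSpace T] [TopologicalSpace P] (κ : T → α → ℝ)
    (hκ : ∀ a, Continuous fun t => κ t a) (hlf : LocallyFinite fun a => {t | κ t a ≠ 0})
    (Φ : T → P) (h : ∀ t0, ContinuousOn Φ {t | ∀ a, κ t a ≠ 0 → κ t0 a ≠ 0}) :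
    Continuous Φ := by
  have hB : LocallyFinite fun s : Set α => {t : T | {a | κ t a ≠ 0} = s} := by
    intro t
    obtain ⟨N, hN, hf⟩ := hlf t
    refine ⟨N, hN, hf.finite_subsets.subset ?_⟩
    rintro s ⟨t', ht', hN'⟩ a ha
    simp only [mem_ofPred_eq] at ht'
    rw [← ht'] at ha
    exact ⟨t', ha, hN'⟩
  refine hB.continuous' ?_ ?_
  · rw [eq_univ_iff_forall]; intro t
    exact mem_iUnion.2 ⟨{a | κ t a ≠ 0}, rfl⟩
  · intro s x hx
    obtain ⟨t0, ht0⟩ : {t : T | {a | κ t a ≠ 0} = s}.Nonempty := by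
      rw [← closure_nonempty_iff]; exact ⟨x, hx⟩
    have hcl : IsClosed {t | ∀ a, κ t a ≠ 0 → κ t0 a ≠ 0} := by
      have : {t | ∀ a, κ t a ≠ 0 → κ t0 a ≠ 0} = ⋂ a, ⋂ (_ : κ t0 a = 0), {t | κ t a = 0} := by
        ext t
        simp only [mem_iInter, mem_ofPred_eq]
        refine forall_congr' fun a => ?_
        tauto
      rw [this]
      exact isClosed_iInter fun a => isClosed_iInter fun _ => isClosed_eq (hκ a) continuous_const
    have hsub : {t : T | {a | κ t a ≠ 0} = s} ⊆ {t | ∀ a, κ t a ≠ 0 → κ t0 a ≠ 0} := by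
      intro t ht a ha
      simp only [mem_ofPred_eq] at ht ht0
      have h1 : a ∈ {a | κ t a ≠ 0} := ha
      rw [ht, ← ht0] at h1
      exact h1
    exact (h t0 x (closure_minimal hsub hcl hx)).mono hsub

structure IsPU {T X : Type*} [TopologicalSpace T] (ξ : T → X) (R : Set (Set X))
    (κ : T → Set X → ℝ) : Prop where
  cont : ∀ a, Continuous fun t => κ t a
  lf : LocallyFinite fun a => {t | κ t a ≠ 0}
  mem : ∀ t, ∃ s : Finset (Set X), (∀ a ∈ s, a ∈ R ∧ ξ t ∈ a) ∧ κ t ∈ Dl s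

theorem nv_of {X : Type*} {R : Set (Set X)} {s : Finset (Set X)} {x : X}
    (h : ∀ a ∈ s, a ∈ R ∧ x ∈ a) {p : Set X → ℝ} (hp : p ∈ Dl s) : s ∈ Nv R ∧ x ∈ Qs s := by
  refine ⟨⟨?_, fun a ha => (h a ha).1, x, fun a ha => (h a ha).2⟩, fun a ha => (h a ha).2⟩
  by_contra hne
  rw [Finset.not_nonempty_iff_eq_empty] at hne
  rw [hne, Dl_empty] at hp
  exact hp

theorem exists_pu {X : Type*} [MetricSpace X] {R : Set (Set X)} (hR : OCov R) :
    ∃ κ : X → Set X → ℝ, IsPU id R κ := by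
  obtain ⟨f, hf⟩ := PartitionOfUnity.exists_isSubordinate (s := (univ : Set X)) isClosed_univ
    (fun r : Set X => if r ∈ R then r else ∅)
    (by intro r; by_cases h : r ∈ R <;> simp [h, hR.1 r])
    (by
      intro x _
      obtain ⟨V, hV, hx⟩ := hR.2 x
      exact mem_iUnion.2 ⟨V, by simpa [hV] using hx⟩)
  refine ⟨fun x a => f a x, fun a => (f a).continuous, f.locallyFinite, fun x => ?_⟩
  refine ⟨f.finsupport x, ?_, fun a => f.nonneg a x, ?_, f.sum_finsupport (mem_univ x)⟩
  · intro a ha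
    have h1 : f a x ≠ 0 := by simpa using ha
    have h2 := hf a (subset_tsupport _ h1)
    by_cases h : a ∈ R
    · simp only [h, if_true] at h2
      exact ⟨h, h2⟩
    · simp [h] at h2
  · intro a ha
    by_contra h
    exact ha (by simpa using h)

theorem pu_comp {T X P : Type*} [TopologicalSpace T] [TopologicalSpace P] {ξ : T → X}
    {R : Set (Set X)} {κ : T → Set X → ℝ} (hκ : IsPU ξ R κ) (θ : (Set X → ℝ) × ℝ → P)
    (hθ : ∀ s ∈ Nv R, ContinuousOn θ (Pr s)) (τ : T → ℝ) (hτ : Continuous τ)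
    (hτI : ∀ t, τ t ∈ Icc (0 : ℝ) 1) : Continuous fun t => θ (κ t, τ t) := by
  refine glue κ hκ.cont hκ.lf _ fun t0 => ?_
  obtain ⟨s0, h0, hs0⟩ := hκ.mem t0
  refine (hθ s0 (nv_of h0 hs0).1).comp
    ((continuous_pi hκ.cont).prodMk hτ).continuousOn ?_
  intro t ht
  obtain ⟨s, _, hs⟩ := hκ.mem t
  exact ⟨Dl_of_supp hs fun a ha => Dl_supp hs0 (ht a ha), hτI t⟩

theorem pu_comp' {T X P : Type*} [TopologicalSpace T] [TopologicalSpace P] {ξ : T → X}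
    {R : Set (Set X)} {κ : T → Set X → ℝ} (hκ : IsPU ξ R κ) (φ : (Set X → ℝ) → P)
    (hφ : ∀ s ∈ Nv R, ContinuousOn φ (Dl s)) : Continuous fun t => φ (κ t) :=
  pu_comp hκ (fun q => φ q.1) (fun s hs => (hφ s hs).comp continuousOn_fst fun _ hq => hq.1)
    (fun _ => 0) continuous_const (fun _ => ⟨le_rfl, zero_le_one⟩)

theorem pu_pre {T S X : Type*} [TopologicalSpace T] [TopologicalSpace S] {ξ : T → X}
    {R : Set (Set X)} {κ : T → Set X → ℝ} (hκ : IsPU ξ R κ) (g : S → T) (hg : Continuous g) :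
    IsPU (ξ ∘ g) R (κ ∘ g) :=
  ⟨fun a => (hκ.cont a).comp hg, hκ.lf.preimage_continuous hg, fun t => hκ.mem (g t)⟩

theorem pu_line {T X : Type*} [TopologicalSpace T] {ξ : T → X}
    {R : Set (Set X)} {κ μ : T → Set X → ℝ} (hκ : IsPU ξ R κ) (hμ : IsPU ξ R μ) (τ : T → ℝ)
    (hτ : Continuous τ) (hτI : ∀ t, τ t ∈ Icc (0 : ℝ) 1) :
    IsPU ξ R (fun t a => (1 - τ t) * κ t a + τ t * μ t a) := by
  have h3 : ∀ t a, (1 - τ t) * κ t a + τ t * μ t a ≠ 0 → κ t a ≠ 0 ∨ μ t a ≠ 0 := by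
    intro t a h
    by_contra! h'
    rw [h'.1, h'.2] at h; simp at h
  refine ⟨fun a => ?_, ?_, fun t => ?_⟩
  · have := hκ.cont a
    have := hμ.cont a
    fun_prop
  · intro t
    obtain ⟨N1, h1, f1⟩ := hκ.lf t
    obtain ⟨N2, h2, f2⟩ := hμ.lf t
    refine ⟨N1 ∩ N2, Filter.inter_mem h1 h2, (f1.union f2).subset ?_⟩
    rintro a ⟨t', ht, hN⟩
    rcases h3 t' a ht with h | h
    · exact Or.inl ⟨t', h, hN.1⟩
    · exact Or.inr ⟨t', h, hN.2⟩
  · obtain ⟨s1, h1, d1⟩ := hκ.mem t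
    obtain ⟨s2, h2, d2⟩ := hμ.mem t
    have e1 := Dl_mono (Finset.subset_union_left (s₁ := s1) (s₂ := s2)) d1
    have e2 := Dl_mono (Finset.subset_union_right (s₁ := s1) (s₂ := s2)) d2
    refine ⟨s1 ∪ s2, ?_, ?_, ?_, ?_⟩
    · intro a ha
      rcases Finset.mem_union.1 ha with h | h
      exacts [h1 a h, h2 a h]
    · intro a
      have := hτI t
      exact add_nonneg (mul_nonneg (by linarith [this.2]) (d1.1 a)) (mul_nonneg this.1 (d2.1 a))
    · intro a ha
      simp only [e1.2.1 a ha, e2.2.1 a ha]; simp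
    · rw [Finset.sum_add_distrib, ← Finset.mul_sum, ← Finset.mul_sum, e1.2.2, e2.2.2]; ring

noncomputable def pushP {α β : Type*} (π : α → β) (p : α → ℝ) (r : β) : ℝ :=
  ∑ᶠ a, if π a = r then p a else 0

theorem pushP_eq {α β : Type*} (π : α → β) {s : Finset α} {p : α → ℝ} (hp : p ∈ Dl s) (r : β) :
    pushP π p r = ∑ a ∈ s, if π a = r then p a else 0 := by
  refine finsum_eq_sum_of_support_subset _ ?_
  intro a ha
  simp only [Function.mem_support] at ha
  refine Dl_supp hp (a := a) fun h => ha ?_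
  simp [h]

theorem pushP_mem {α β : Type*} (π : α → β) {s : Finset α} {p : α → ℝ} (hp : p ∈ Dl s) :
    pushP π p ∈ Dl (s.image π) := by
  refine ⟨fun r => ?_, fun r hr => ?_, ?_⟩
  · rw [pushP_eq π hp]
    exact Finset.sum_nonneg fun a _ => by split_ifs; exacts [hp.1 a, le_rfl]
  · rw [pushP_eq π hp]
    refine Finset.sum_eq_zero fun a ha => if_neg fun h => hr ?_
    exact Finset.mem_image.2 ⟨a, ha, h⟩
  · rw [← hp.2.2, ← Finset.sum_fiberwise_of_maps_to (g := π) (t := s.image π)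
      (fun a ha => Finset.mem_image_of_mem _ ha)]
    refine Finset.sum_congr rfl fun r _ => ?_
    rw [pushP_eq π hp, Finset.sum_filter]

theorem pushP_cont {α β : Type*} (π : α → β) (s : Finset α) : ContinuousOn (pushP π) (Dl s) := by
  refine continuousOn_pi.2 fun r => ?_
  have : ContinuousOn (fun p : α → ℝ => ∑ a ∈ s, if π a = r then p a else 0) (Dl s) := by
    refine Continuous.continuousOn (continuous_finsetSum _ fun a _ => ?_)
    split_ifs <;> fun_prop
  exact this.congr fun p hp => pushP_eq π hp r

theorem pu_push {T X : Type*} [TopologicalSpace T] {ξ : T → X}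
    {R R' : Set (Set X)} {κ : T → Set X → ℝ} (hκ : IsPU ξ R' κ) (π : Set X → Set X)
    (hπ : ∀ r ∈ R', π r ∈ R ∧ r ⊆ π r) : IsPU ξ R (fun t => pushP π (κ t)) := by
  have key : ∀ t r, pushP π (κ t) r ≠ 0 → ∃ a, π a = r ∧ κ t a ≠ 0 := by
    intro t r h
    obtain ⟨s, -, hs⟩ := hκ.mem t
    rw [pushP_eq π hs] at h
    obtain ⟨a, -, ha⟩ := Finset.exists_ne_zero_of_sum_ne_zero h
    by_cases h1 : π a = r
    · exact ⟨a, h1, by simpa [h1] using ha⟩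
    · simp [h1] at ha
  refine ⟨fun r => ?_, ?_, fun t => ?_⟩
  · refine continuous_finsum (fun a => ?_) ?_
    · have := hκ.cont a
      split_ifs <;> fun_prop
    · refine hκ.lf.subset fun a t ht h => ?_
      simp only [Function.mem_support] at ht
      simp [h] at ht
  · intro t
    obtain ⟨N, hN, hf⟩ := hκ.lf t
    refine ⟨N, hN, (hf.image π).subset ?_⟩
    rintro r ⟨t', ht, hN'⟩
    obtain ⟨a, h1, h2⟩ := key t' r ht
    exact ⟨a, ⟨t', h2, hN'⟩, h1⟩
  · obtain ⟨s, h, hs⟩ := hκ.mem t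
    refine ⟨s.image π, ?_, pushP_mem π hs⟩
    intro r hr
    obtain ⟨a, ha, rfl⟩ := Finset.mem_image.1 hr
    exact ⟨(hπ a (h a ha).1).1, (hπ a (h a ha).1).2 (h a ha).2⟩

def Refi {α : Type*} (D C : Set (Set α)) : Prop := ∀ V ∈ D, ∃ W ∈ C, V ⊆ W

theorem cov_and {P : Type*} [TopologicalSpace P] {C D : Set (Set P)} (hC : OCov C) (hD : OCov D) :
    ∃ E : Set (Set P), OCov E ∧ Refi E C ∧ Refi E D := by
  refine ⟨{V | ∃ A ∈ C, ∃ B ∈ D, V = A ∩ B}, ⟨?_, fun y => ?_⟩, ?_, ?_⟩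
  · rintro _ ⟨A, hA, B, hB, rfl⟩
    exact (hC.1 A hA).inter (hD.1 B hB)
  · obtain ⟨A, hA, h1⟩ := hC.2 y
    obtain ⟨B, hB, h2⟩ := hD.2 y
    exact ⟨_, ⟨A, hA, B, hB, rfl⟩, h1, h2⟩
  · rintro _ ⟨A, hA, B, hB, rfl⟩
    exact ⟨A, hA, inter_subset_left⟩
  · rintro _ ⟨A, hA, B, hB, rfl⟩
    exact ⟨B, hB, inter_subset_right⟩

structure Apx (X P : Type*) where
  R : Set (Set X)
  κ : X → Set X → ℝ
  φ : (Set X → ℝ) → P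

structure Apx.Is {X P : Type*} [TopologicalSpace X] [TopologicalSpace P] (n : ℕ) (F : X → P)
    (C : Set (Set P)) (A : Apx X P) : Prop where
  cov : OCov A.R
  ord : Ordn n A.R
  pu : IsPU id A.R A.κ
  c : ∀ s ∈ Nv A.R, ContinuousOn A.φ (Dl s)
  g : ∀ s ∈ Nv A.R, ∃ V ∈ C, A.φ '' Dl s ⊆ V ∧ F '' Qs s ⊆ V

theorem Apx.Is.mono {X P : Type*} [TopologicalSpace X] [TopologicalSpace P] {n : ℕ} {F : X → P}
    {C D : Set (Set P)} {A : Apx X P} (h : A.Is n F D) (hD : Refi D C) : A.Is n F C := by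
  refine ⟨h.cov, h.ord, h.pu, h.c, fun s hs => ?_⟩
  obtain ⟨V, hV, h1, h2⟩ := h.g s hs
  obtain ⟨W, hW, h3⟩ := hD V hV
  exact ⟨W, hW, h1.trans h3, h2.trans h3⟩

theorem apx_exists {X P : Type*} [MetricSpace X] [Nonempty X] [MetricSpace P] {n : ℕ} (hLC : LCn n P)
    (hdim : CovDimLT X n) {F : X → P} (hF : Continuous F) {C : Set (Set P)} (hC : OCov C)
    {R0 : Set (Set X)} (hR0 : OCov R0) : ∃ A : Apx X P, A.Is n F C ∧ Refi A.R R0 := by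
  obtain ⟨C', hC', hcp⟩ := cover_prism hLC F hC
  obtain ⟨E, hE, hE1, hE2⟩ := cov_and hR0 (D := {r | ∃ V ∈ C', r = F ⁻¹' V}) (by
    refine ⟨?_, fun x => ?_⟩
    · rintro _ ⟨V, hV, rfl⟩
      exact (hC'.1 V hV).preimage hF
    · obtain ⟨V, hV, h⟩ := hC'.2 (F x)
      exact ⟨_, ⟨V, hV, rfl⟩, h⟩)
  obtain ⟨R, hRo, hRc, hRE, hRn⟩ := hdim E hE.1 (by
    rw [eq_univ_iff_forall]; intro x
    obtain ⟨V, hV, h⟩ := hE.2 x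
    exact ⟨V, hV, h⟩)
  have hRcov : OCov R := ⟨hRo, fun x => by
    have : x ∈ ⋃₀ R := by rw [hRc]; trivial
    exact this⟩
  obtain ⟨κ, hκ⟩ := exists_pu hRcov
  have hreal : ∀ s ∈ Nv R, ∃ V ∈ C', F '' Qs s ⊆ V := by
    intro s hs
    obtain ⟨r, hr⟩ := hs.1
    obtain ⟨e, he, hre⟩ := hRE r (hs.2.1 r hr)
    obtain ⟨_, ⟨V, hV, rfl⟩, h⟩ := hE2 e he
    refine ⟨V, hV, ?_⟩
    rintro _ ⟨x, hx, rfl⟩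
    exact h (hre (hx r hr))
  obtain ⟨p0⟩ : Nonempty P := ‹Nonempty X›.map F
  obtain ⟨θ, hθ⟩ := hcp R hRn ∅ isClosed_empty (fun _ => p0)
    (fun s _ => continuousOn_const) (by
      intro s hs
      obtain ⟨V, hV, h⟩ := hreal s hs
      exact ⟨V, hV, by simp, h⟩)
  have hmt : ∀ s : Finset (Set X), MapsTo (fun p : Set X → ℝ => (p, (0 : ℝ))) (Dl s) (Pr s) :=
    fun s p hp => ⟨hp, le_rfl, zero_le_one⟩
  refine ⟨⟨R, κ, fun p => θ (p, 0)⟩, ⟨hRcov, hRn, hκ, fun s hs => ?_, fun s hs => ?_⟩, ?_⟩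
  · exact (hθ s hs).1.comp (by fun_prop) (hmt s)
  · obtain ⟨V, hV, h1, h2⟩ := (hθ s hs).2.2
    refine ⟨V, hV, ?_, h2⟩
    rintro _ ⟨p, hp, rfl⟩
    exact h1 ⟨_, hmt s hp, rfl⟩
  · intro r hr
    obtain ⟨e, he, hre⟩ := hRE r hr
    obtain ⟨w, hw, h⟩ := hE1 e he
    exact ⟨w, hw, hre.trans h⟩

def Hty {X P : Type*} [TopologicalSpace X] [TopologicalSpace P] (C : Set (Set P))
    (F a b : X → P) : Prop :=
  ∃ h : ℝ × X → P, Continuous h ∧ (∀ t x, t ≤ 0 → h (t, x) = a x) ∧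
    (∀ t x, 1 ≤ t → h (t, x) = b x) ∧ ∀ t x, ∃ V ∈ C, h (t, x) ∈ V ∧ F x ∈ V

theorem Hty.trans {X P : Type*} [TopologicalSpace X] [TopologicalSpace P] {C : Set (Set P)}
    {F a b c : X → P} (h1 : Hty C F a b) (h2 : Hty C F b c) : Hty C F a c := by
  obtain ⟨h, hc, h0, h1, hC⟩ := h1
  obtain ⟨k, kc, k0, k1, kC⟩ := h2
  refine ⟨fun q => if q.1 ≤ 1 / 2 then h (2 * q.1, q.2) else k (2 * q.1 - 1, q.2), ?_, ?_, ?_, ?_⟩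
  · refine continuous_if_le continuous_fst continuous_const
      (Continuous.continuousOn (by fun_prop)) (Continuous.continuousOn (by fun_prop)) ?_
    intro q hq
    rw [h1 _ _ (by linarith), k0 _ _ (by linarith)]
  · intro t x ht
    simp only
    rw [if_pos (by linarith), h0 _ _ (by linarith)]
  · intro t x ht
    simp only
    rw [if_neg (by linarith), k1 _ _ (by linarith)]
  · intro t x
    simp only
    split_ifs
    exacts [hC _ _, kC _ _]

theorem Hty.mono {X P : Type*} [TopologicalSpace X] [TopologicalSpace P] {C D : Set (Set P)}
    {F a b : X → P} (h1 : Hty D F a b) (hD : Refi D C) : Hty C F a b := by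
  obtain ⟨h, hc, h0, h1, hC⟩ := h1
  refine ⟨h, hc, h0, h1, fun t x => ?_⟩
  obtain ⟨V, hV, e1, e2⟩ := hC t x
  obtain ⟨W, hW, e⟩ := hD V hV
  exact ⟨W, hW, e e1, e e2⟩

noncomputable def clp (t : ℝ) : ℝ := max 0 (min t 1)

theorem clp_cont : Continuous clp := by unfold clp; fun_prop

theorem clp_mem (t : ℝ) : clp t ∈ Icc (0 : ℝ) 1 :=
  ⟨le_max_left _ _, max_le zero_le_one (min_le_right _ _)⟩

theorem clp_le {t : ℝ} (h : t ≤ 0) : clp t = 0 := by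
  unfold clp; rw [min_eq_left (by linarith), max_eq_left h]

theorem clp_ge {t : ℝ} (h : 1 ≤ t) : clp t = 1 := by
  unfold clp; rw [min_eq_right h, max_eq_right zero_le_one]

theorem apx_link {X P : Type*} [MetricSpace X] [MetricSpace P] {n : ℕ} (hLC : LCn n P)
    (F : X → P) {C : Set (Set P)} (hC : OCov C) : ∃ C' : Set (Set P), OCov C' ∧
    ∀ A A' : Apx X P, A.Is n F C' → A'.Is n F C' → Refi A'.R A.R →
      Hty C F (fun x => A.φ (A.κ x)) (fun x => A'.φ (A'.κ x)) := by
  obtain ⟨C1, hC1, hcp⟩ := cover_prism hLC F hC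
  obtain ⟨E, hE, hE1, hE2⟩ := cov_and hC hC1
  obtain ⟨C', hC', hst⟩ := star_ref hE
  refine ⟨C', hC', fun A A' hA hA' href => ?_⟩
  have : ∃ π : Set X → Set X, ∀ r ∈ A'.R, π r ∈ A.R ∧ r ⊆ π r := by
    have h : ∀ r, ∃ w, r ∈ A'.R → w ∈ A.R ∧ r ⊆ w := by
      intro r
      by_cases hr : r ∈ A'.R
      · obtain ⟨w, hw, h⟩ := href r hr
        exact ⟨w, fun _ => ⟨hw, h⟩⟩
      · exact ⟨r, fun h => absurd h hr⟩
    choose π hπ using h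
    exact ⟨π, hπ⟩
  obtain ⟨π, hπ⟩ := this
  have hpush := pu_push hA'.pu π hπ
  have hnv : ∀ s ∈ Nv A'.R, s.image π ∈ Nv A.R ∧ Qs s ⊆ Qs (s.image π) := by
    intro s hs
    have hq : Qs s ⊆ Qs (s.image π) := by
      intro x hx r hr
      obtain ⟨a, ha, rfl⟩ := Finset.mem_image.1 hr
      exact (hπ a (hs.2.1 a ha)).2 (hx a ha)
    refine ⟨⟨hs.1.image π, ?_, hs.2.2.mono hq⟩, hq⟩
    intro r hr
    obtain ⟨a, ha, rfl⟩ := Finset.mem_image.1 hr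
    exact (hπ a (hs.2.1 a ha)).1
  refine Hty.trans (b := fun x => A.φ (pushP π (A'.κ x))) ?_ ?_
  · have hl := pu_line (pu_pre hA.pu (Prod.snd : ℝ × X → X) continuous_snd)
      (pu_pre hpush (Prod.snd : ℝ × X → X) continuous_snd) (fun q => clp q.1)
      (clp_cont.comp continuous_fst) (fun q => clp_mem _)
    refine ⟨_, pu_comp' hl A.φ hA.c, ?_, ?_, ?_⟩
    · intro t x ht
      simp [clp_le ht]
    · intro t x ht
      simp [clp_ge ht]
    · intro t x
      obtain ⟨s, h1, h2⟩ := hl.mem (t, x)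
      obtain ⟨h3, h4⟩ := nv_of h1 h2
      obtain ⟨V, hV, h5, h6⟩ := hA.g s h3
      obtain ⟨W, hW, hVW⟩ := hst (F x)
      obtain ⟨Z, hZ, hWZ⟩ := hE1 W hW
      have hFx : F x ∈ V := h6 ⟨x, h4, rfl⟩
      exact ⟨Z, hZ, hWZ (hVW V hV hFx (h5 ⟨_, h2, rfl⟩)), hWZ (hVW V hV hFx hFx)⟩
  · obtain ⟨θ, hθ⟩ := hcp A'.R hA'.ord (univ ×ˢ {0, 1})
      (isClosed_univ.prod (by simp))
      (fun q => if q.2 = 0 then A.φ (pushP π q.1) else A'.φ q.1) (by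
        intro s hs
        have e : (univ ×ˢ {0, 1}) ∩ Pr s = (Dl s ×ˢ {(0 : ℝ)}) ∪ (Dl s ×ˢ {(1 : ℝ)}) := by
          ext ⟨p, t⟩
          simp only [Pr, mem_inter_iff, mem_prod, mem_univ, true_and, mem_insert_iff,
            mem_singleton_iff, mem_union]
          constructor
          · rintro ⟨h | h, h2, -⟩
            exacts [Or.inl ⟨h2, h⟩, Or.inr ⟨h2, h⟩]
          · rintro (⟨h, rfl⟩ | ⟨h, rfl⟩) <;> simp [h]
        rw [e]
        refine ContinuousOn.union_of_isClosed ?_ ?_ ((Dl_compact s).isClosed.prod isClosed_singleton)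
          ((Dl_compact s).isClosed.prod isClosed_singleton)
        · have : ContinuousOn (fun q : (Set X → ℝ) × ℝ => A.φ (pushP π q.1)) (Dl s ×ˢ {(0 : ℝ)}) :=
            (hA.c _ (hnv s hs).1).comp ((pushP_cont π s).comp continuousOn_fst fun q hq => hq.1)
              fun q hq => pushP_mem π hq.1
          refine this.congr ?_
          rintro ⟨p, t⟩ ⟨-, ht⟩
          simp only [mem_singleton_iff] at ht
          simp [ht]
        · have : ContinuousOn (fun q : (Set X → ℝ) × ℝ => A'.φ q.1) (Dl s ×ˢ {(1 : ℝ)}) :=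
            (hA'.c _ hs).comp continuousOn_fst fun q hq => hq.1
          refine this.congr ?_
          rintro ⟨p, t⟩ ⟨-, ht⟩
          simp only [mem_singleton_iff] at ht
          simp [ht]) (by
        intro s hs
        obtain ⟨x, hx⟩ := hs.2.2
        obtain ⟨V1, hV1, h1, h2⟩ := hA.g _ (hnv s hs).1
        obtain ⟨V2, hV2, h3, h4⟩ := hA'.g s hs
        obtain ⟨W, hW, hVW⟩ := hst (F x)
        obtain ⟨Z, hZ, hWZ⟩ := hE2 W hW
        have i1 := (hVW V1 hV1 (h2 ⟨x, (hnv s hs).2 hx, rfl⟩)).trans hWZ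
        have i2 := (hVW V2 hV2 (h4 ⟨x, hx, rfl⟩)).trans hWZ
        refine ⟨Z, hZ, ?_, h4.trans i2⟩
        rintro _ ⟨⟨p, t⟩, ⟨-, hp⟩, rfl⟩
        simp only
        split_ifs
        · exact i1 (h1 ⟨_, pushP_mem π hp.1, rfl⟩)
        · exact i2 (h3 ⟨_, hp.1, rfl⟩))
    have hl := pu_pre hA'.pu (Prod.snd : ℝ × X → X) continuous_snd
    refine ⟨_, pu_comp hl θ (fun s hs => (hθ s hs).1) (fun q => clp q.1)
      (clp_cont.comp continuous_fst) (fun q => clp_mem _), ?_, ?_, ?_⟩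
    · intro t x ht
      obtain ⟨s, h1, h2⟩ := hA'.pu.mem x
      have h3 := (nv_of h1 h2).1
      have := (hθ s h3).2.1 (x := (A'.κ x, 0)) ⟨by simp, h2, by simp⟩
      simpa [clp_le ht] using this
    · intro t x ht
      obtain ⟨s, h1, h2⟩ := hA'.pu.mem x
      have h3 := (nv_of h1 h2).1
      have := (hθ s h3).2.1 (x := (A'.κ x, 1)) ⟨by simp, h2, by simp⟩
      simpa [clp_ge ht] using this
    · intro t x
      obtain ⟨s, h1, h2⟩ := hA'.pu.mem x
      have h3 := nv_of h1 h2
      obtain ⟨V, hV, h4, h5⟩ := (hθ s h3.1).2.2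
      exact ⟨V, hV, h4 ⟨_, ⟨h2, clp_mem t⟩, rfl⟩, h5 ⟨x, h3.2, rfl⟩⟩

theorem tele {X P : Type*} [TopologicalSpace X] [MetricSpace P] {F : X → P} (hF : Continuous F)
    (C : Set (Set P)) (hC : OCov C) (E : ℕ → Set (Set P)) (hEC : ∀ m, Refi (E m) C)
    (hEd : ∀ m, ∀ V ∈ E m, ∀ p ∈ V, ∀ q ∈ V, dist p q ≤ 1 / ((m : ℝ) + 1))
    (a : ℕ → X → P) (ha : ∀ m, Hty (E m) F (a m) (a (m + 1))) : Hty C F F (a 0) := by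
  choose h hc h0 h1 hE using ha
  let G : ℝ × X → P := fun q => h ⌊q.1⌋₊ (q.1 - ⌊q.1⌋₊, q.2)
  have hG0 : ∀ t x, t ≤ 0 → G (t, x) = a 0 x := by
    intro t x ht
    simp only [G]
    rw [Nat.floor_of_nonpos ht]
    exact h0 0 _ _ (by simpa using ht)
  have hGc : Continuous G := by
    let S : ℕ → Set (ℝ × X) := fun m => {q | (m : ℝ) ≤ max q.1 0 ∧ max q.1 0 ≤ m + 1}
    have hlf : LocallyFinite S := by
      rintro ⟨t, x⟩
      obtain ⟨N, hN⟩ := exists_nat_gt (max t 0)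
      refine ⟨{q | max q.1 0 < N}, ?_, (finite_Iio N).subset ?_⟩
      · exact (isOpen_lt (by fun_prop) continuous_const).mem_nhds hN
      · rintro m ⟨q, hq, hq2⟩
        have h1 : (m : ℝ) < N := hq.1.trans_lt hq2
        exact_mod_cast h1
    refine hlf.continuous ?_ (fun m => ?_) (fun m => ?_)
    · rw [eq_univ_iff_forall]; intro q
      refine mem_iUnion.2 ⟨⌊max q.1 0⌋₊, Nat.floor_le (le_max_right _ _), (Nat.lt_floor_add_one _).le⟩
    · have hm : Continuous fun q : ℝ × X => max q.1 0 := by fun_prop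
      exact (isClosed_le continuous_const hm).inter (isClosed_le hm continuous_const)
    · have hh : Continuous fun q : ℝ × X => h m (q.1 - m, q.2) := by
        have := hc m
        fun_prop
      refine hh.continuousOn.congr ?_
      rintro ⟨t, x⟩ ⟨hq1, hq2⟩
      simp only at hq1 hq2
      rcases le_or_gt t 0 with ht | ht
      · rw [max_eq_right ht] at hq1
        have hm : m = 0 := by
          have : (m : ℝ) = 0 := le_antisymm hq1 (Nat.cast_nonneg m)
          exact_mod_cast this
        subst hm
        rw [hG0 t x ht]
        exact (h0 0 _ _ (by simpa using ht)).symm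
      · rw [max_eq_left ht.le] at hq1 hq2
        rcases hq2.lt_or_eq with hlt | heq
        · have : ⌊t⌋₊ = m := (Nat.floor_eq_iff ht.le).2 ⟨hq1, hlt⟩
          simp only [G, this]
        · have : ⌊t⌋₊ = m + 1 := by
            rw [heq]; exact_mod_cast Nat.floor_natCast (R := ℝ) (m + 1)
          simp only [G, this]
          rw [h0 (m + 1) _ _ (by push_cast; linarith), h1 m _ _ (by linarith)]
  have hGE : ∀ t x, ∃ V ∈ E ⌊t⌋₊, G (t, x) ∈ V ∧ F x ∈ V := fun t x => hE _ _ x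
  let H : ℝ × X → P := fun q => if q.1 ≤ 0 then F q.2 else G (1 / q.1 - 1, q.2)
  have hH0 : ∀ t x, t ≤ 0 → H (t, x) = F x := fun t x ht => by simp only [H, if_pos ht]
  have hH1 : ∀ t x, 0 < t → H (t, x) = G (1 / t - 1, x) :=
    fun t x ht => by simp only [H, if_neg (not_le.2 ht)]
  refine ⟨H, ?_, hH0, ?_, ?_⟩
  · rw [continuous_iff_continuousAt]
    rintro ⟨t, x⟩
    rcases lt_trichotomy t 0 with ht | ht | ht
    · have : (fun q : ℝ × X => F q.2) =ᶠ[nhds (t, x)] H := by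
        filter_upwards [(isOpen_lt continuous_fst continuous_const).mem_nhds
          (show (t, x) ∈ {q : ℝ × X | q.1 < 0} from ht)] with q hq
        exact (hH0 q.1 q.2 (le_of_lt hq)).symm
      exact ((hF.comp continuous_snd).continuousAt).congr this
    · subst ht
      have hx0 : H (0, x) = F x := hH0 0 x le_rfl
      refine Metric.tendsto_nhds.2 fun ε hε => ?_
      rw [hx0]
      obtain ⟨N, hN⟩ := exists_nat_one_div_lt (half_pos hε)
      have hNp : (0 : ℝ) < 1 / ((N : ℝ) + 1) := by positivity
      have c1 : ∀ᶠ q : ℝ × X in nhds (0, x), dist (F q.2) (F x) < ε / 2 :=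
        (hF.comp continuous_snd).continuousAt.eventually (ball_mem_nhds _ (half_pos hε))
      have c2 : ∀ᶠ q : ℝ × X in nhds (0, x), q.1 < 1 / ((N : ℝ) + 1) :=
        (isOpen_lt continuous_fst continuous_const).mem_nhds
          (show ((0 : ℝ), x) ∈ {q : ℝ × X | q.1 < 1 / ((N : ℝ) + 1)} from hNp)
      filter_upwards [c1, c2] with q hq1 hq2
      obtain ⟨t, y⟩ := q
      simp only at hq1 hq2
      rcases le_or_gt t 0 with ht | ht
      · rw [hH0 t y ht]; linarith
      · rw [hH1 t y ht]
        obtain ⟨V, hV, e1, e2⟩ := hGE (1 / t - 1) y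
        have d1 := hEd _ V hV _ e1 _ e2
        have hfl : N ≤ ⌊1 / t - 1⌋₊ := by
          refine Nat.le_floor ?_
          rw [lt_div_iff₀ (by positivity)] at hq2
          rw [le_sub_iff_add_le, le_div_iff₀ ht]
          linarith
        have d2 : 1 / ((⌊1 / t - 1⌋₊ : ℝ) + 1) ≤ 1 / ((N : ℝ) + 1) := by
          apply one_div_le_one_div_of_le (by positivity)
          have : (N : ℝ) ≤ ⌊1 / t - 1⌋₊ := by exact_mod_cast hfl
          linarith
        have d3 := dist_triangle (G (1 / t - 1, y)) (F y) (F x)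
        linarith
    · have : (fun q : ℝ × X => G (1 / q.1 - 1, q.2)) =ᶠ[nhds (t, x)] H := by
        filter_upwards [(isOpen_lt continuous_const continuous_fst).mem_nhds
          (show (t, x) ∈ {q : ℝ × X | 0 < q.1} from ht)] with q hq
        exact (hH1 q.1 q.2 hq).symm
      refine ContinuousAt.congr ?_ this
      refine hGc.continuousAt.comp ?_
      have : ContinuousAt (fun q : ℝ × X => 1 / q.1) (t, x) :=
        continuousAt_const.div continuousAt_fst ht.ne'
      exact (this.sub continuousAt_const).prodMk continuousAt_snd
  · intro t x ht
    rw [hH1 t x (by linarith)]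
    apply hG0
    rw [sub_nonpos, div_le_one (by linarith)]
    exact ht
  · intro t x
    rcases le_or_gt t 0 with ht | ht
    · rw [hH0 t x ht]
      obtain ⟨V, hV, h⟩ := hC.2 (F x)
      exact ⟨V, hV, h, h⟩
    · rw [hH1 t x ht]
      obtain ⟨V, hV, e1, e2⟩ := hGE (1 / t - 1) x
      obtain ⟨W, hW, e⟩ := hEC _ V hV
      exact ⟨W, hW, e e1, e e2⟩

theorem apx_hty {X P : Type*} [MetricSpace X] [Nonempty X] [MetricSpace P] {n : ℕ} (hLC : LCn n P)
    (hdim : CovDimLT X n) {F : X → P} (hF : Continuous F) {C : Set (Set P)} (hC : OCov C)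
    {R0 : Set (Set X)} (hR0 : OCov R0) : ∃ A : Apx X P, A.Is n F C ∧ Refi A.R R0 ∧
      Hty C F F (fun x => A.φ (A.κ x)) := by
  let E : ℕ → Set (Set P) := fun m => {V | IsOpen V ∧ (∃ W ∈ C, V ⊆ W) ∧
    ∀ p ∈ V, ∀ q ∈ V, dist p q ≤ 1 / ((m : ℝ) + 1)}
  have hE : ∀ m, OCov (E m) := by
    intro m
    refine ⟨fun V hV => hV.1, fun y => ?_⟩
    obtain ⟨W, hW, hy⟩ := hC.2 y
    have hpos : (0 : ℝ) < 1 / ((m : ℝ) + 1) / 2 := by positivity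
    refine ⟨W ∩ ball y (1 / ((m : ℝ) + 1) / 2), ⟨(hC.1 W hW).inter isOpen_ball,
      ⟨W, hW, inter_subset_left⟩, ?_⟩, hy, mem_ball_self hpos⟩
    rintro p ⟨-, hp⟩ q ⟨-, hq⟩
    rw [mem_ball] at hp hq
    have := dist_triangle_right p q y
    linarith
  choose E' hE' hlink using fun m => apx_link hLC F (hE m)
  have hD : ∀ m, ∃ D : Set (Set P), OCov D ∧ Refi D (E' m) ∧
      Refi D (if m = 0 then C else E' (m - 1)) := by
    intro m
    refine cov_and (hE' m) ?_
    split_ifs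
    exacts [hC, hE' _]
  choose D hD hD1 hD2 using hD
  have hstep : ∀ (m : ℕ) (R : {R : Set (Set X) // OCov R}), ∃ A : {A : Apx X P // OCov A.R},
      A.1.Is n F (D m) ∧ Refi A.1.R R.1 := by
    rintro m ⟨R, hR⟩
    obtain ⟨A, h1, h2⟩ := apx_exists hLC hdim hF (hD m) hR
    exact ⟨⟨A, h1.cov⟩, h1, h2⟩
  choose st hst1 hst2 using hstep
  let A : ℕ → {A : Apx X P // OCov A.R} := fun m =>
    Nat.rec (st 0 ⟨R0, hR0⟩) (fun m B => st (m + 1) ⟨B.1.R, B.2⟩) m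
  have hA : ∀ m, (A m).1.Is n F (D m) := by
    intro m
    cases m with
    | zero => exact hst1 _ _
    | succ m => exact hst1 _ _
  have hAr : ∀ m, Refi (A (m + 1)).1.R (A m).1.R := fun m =>
    hst2 (m + 1) ⟨(A m).1.R, (A m).2⟩
  refine ⟨(A 0).1, (hA 0).mono (by simpa using hD2 0), hst2 0 ⟨R0, hR0⟩, ?_⟩
  refine tele hF C hC E (fun m V hV => hV.2.1) (fun m V hV => hV.2.2)
    (fun m x => (A m).1.φ ((A m).1.κ x)) fun m => ?_
  refine hlink m _ _ ((hA m).mono (hD1 m)) ((hA (m + 1)).mono ?_) (hAr m)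
  simpa using hD2 (m + 1)

def HtQ {X P : Type*} [TopologicalSpace X] [TopologicalSpace P] (Q : X → Set P)
    (a b : X → P) : Prop :=
  ∃ h : ℝ × X → P, Continuous h ∧ (∀ t x, t ≤ 0 → h (t, x) = a x) ∧
    (∀ t x, 1 ≤ t → h (t, x) = b x) ∧ ∀ t x, h (t, x) ∈ Q x

theorem HtQ.trans {X P : Type*} [TopologicalSpace X] [TopologicalSpace P] {Q : X → Set P}
    {a b c : X → P} (h1 : HtQ Q a b) (h2 : HtQ Q b c) : HtQ Q a c := by
  obtain ⟨h, hc, h0, h1, hC⟩ := h1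
  obtain ⟨k, kc, k0, k1, kC⟩ := h2
  refine ⟨fun q => if q.1 ≤ 1 / 2 then h (2 * q.1, q.2) else k (2 * q.1 - 1, q.2), ?_, ?_, ?_, ?_⟩
  · refine continuous_if_le continuous_fst continuous_const
      (Continuous.continuousOn (by fun_prop)) (Continuous.continuousOn (by fun_prop)) ?_
    intro q hq
    rw [h1 _ _ (by linarith), k0 _ _ (by linarith)]
  · intro t x ht
    simp only
    rw [if_pos (by linarith), h0 _ _ (by linarith)]
  · intro t x ht
    simp only
    rw [if_neg (by linarith), k1 _ _ (by linarith)]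
  · intro t x
    simp only
    split_ifs
    exacts [hC _ _, kC _ _]

theorem HtQ.symm {X P : Type*} [TopologicalSpace X] [TopologicalSpace P] {Q : X → Set P}
    {a b : X → P} (h1 : HtQ Q a b) : HtQ Q b a := by
  obtain ⟨h, hc, h0, h1, hC⟩ := h1
  refine ⟨fun q => h (1 - q.1, q.2), by fun_prop, ?_, ?_, fun t x => hC _ _⟩
  · exact fun t x ht => h1 _ _ (by linarith)
  · exact fun t x ht => h0 _ _ (by linarith)

theorem ae_single {ι Y : Type*} [TopologicalSpace Y] {n : ℕ} {U : ι → Set Y}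
    (hcov : IsAECover.{u} n U) (j : ι) (y : Y) (hy : y ∈ U j) : IsAE.{u} n (U j) := by
  have h := hcov.2 {j} (singleton_nonempty j)
  rw [biInter_singleton] at h
  rcases h with h | h
  · rw [h] at hy; exact hy.elim
  · exact h

abbrev Pai {ι Y : Type*} (U : ι → Set Y) := {p : Y × Y // ∃ j, p.1 ∈ U j ∧ p.2 ∈ U j}

theorem lc_pai {ι Y : Type*} [MetricSpace Y] {n : ℕ} {U : ι → Set Y}
    (hopen : ∀ i, IsOpen (U i)) (hcov : IsAECover.{u} n U) : LCn n (Pai U) := by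
  rintro ⟨⟨y1, y2⟩, j, hy1, hy2⟩ O hO hyO
  simp only at hy1 hy2
  obtain ⟨O', hO', rfl⟩ := isOpen_induced_iff.1 hO
  obtain ⟨O1, O2, h1, h2, m1, m2, hsub⟩ := isOpen_prod_iff.1 hO' y1 y2 hyO
  have hA := ae_single hcov j y1 hy1
  obtain ⟨ε1, e1, c1⟩ := lc_of_ae hA y1 hy1 (O1 ∩ U j) (h1.inter (hopen j)) ⟨m1, hy1⟩
  obtain ⟨ε2, e2, c2⟩ := lc_of_ae hA y2 hy2 (O2 ∩ U j) (h2.inter (hopen j)) ⟨m2, hy2⟩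
  refine ⟨{p | p.1.1 ∈ (ball y1 ε1 ∩ U j) ∩ O1 ∧ p.1.2 ∈ (ball y2 ε2 ∩ U j) ∩ O2}, ?_, ?_, ?_, ?_⟩
  · exact (((isOpen_ball.inter (hopen j)).inter h1).preimage
      (continuous_fst.comp continuous_subtype_val)).inter
      (((isOpen_ball.inter (hopen j)).inter h2).preimage
      (continuous_snd.comp continuous_subtype_val))
  · exact ⟨⟨⟨mem_ball_self e1, hy1⟩, m1⟩, ⟨mem_ball_self e2, hy2⟩, m2⟩
  · rintro p ⟨a, b⟩
    exact hsub ⟨a.2, b.2⟩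
  · intro B hB β hβ hm
    obtain ⟨γ1, a1, a2, a3⟩ := c1 B hB (fun q => (β q).1.1)
      ((continuous_fst.comp continuous_subtype_val).comp_continuousOn hβ) (fun q hq => (hm hq).1.1)
    obtain ⟨γ2, b1, b2, b3⟩ := c2 B hB (fun q => (β q).1.2)
      ((continuous_snd.comp continuous_subtype_val).comp_continuousOn hβ) (fun q hq => (hm hq).2.1)
    refine ⟨fun q => ⟨(γ1 q, γ2 q), j, (a3 q).2, (b3 q).2⟩, (a1.prodMk b1).subtype_mk _, ?_, ?_⟩
    · intro q hq
      exact Subtype.ext (Prod.ext (a2 hq) (b2 hq))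
    · intro q
      exact hsub ⟨(a3 q).1, (b3 q).1⟩

theorem main_aux {ι Y X : Type*} [MetricSpace Y] [MetricSpace X] [Nonempty X] {n : ℕ}
    {U : ι → Set Y} (hopen : ∀ i, IsOpen (U i)) (hcov : IsAECover.{u} n U)
    (hdim : CovDimLT X n) (F : X → Pai U) (hF : Continuous F) :
    ∃ j : X → ι, HtQ (fun x => U (j x)) (fun x => (F x).1.1) (fun x => (F x).1.2) := by
  have hLC := lc_pai hopen hcov
  have hB : OCov (range fun j : ι => {p : Pai U | p.1.1 ∈ U j ∧ p.1.2 ∈ U j}) := by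
    refine ⟨?_, ?_⟩
    · rintro _ ⟨j, rfl⟩
      exact ((hopen j).preimage (continuous_fst.comp continuous_subtype_val)).inter
        ((hopen j).preimage (continuous_snd.comp continuous_subtype_val))
    · rintro ⟨p, j, h⟩
      exact ⟨_, ⟨j, rfl⟩, h⟩
  obtain ⟨C1, hC1, hs1⟩ := star_ref hB
  obtain ⟨C, hC, hs⟩ := star_ref hC1
  obtain ⟨A, hA, hAr, hT⟩ := apx_hty hLC hdim hF hC (R0 := {r | ∃ V ∈ C, r = F ⁻¹' V}) (by
    refine ⟨?_, fun x => ?_⟩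
    · rintro _ ⟨V, hV, rfl⟩
      exact (hC.1 V hV).preimage hF
    · obtain ⟨V, hV, h⟩ := hC.2 (F x)
      exact ⟨_, ⟨V, hV, rfl⟩, h⟩)
  let J : Finset (Set X) → Set ι := fun s => {j | ∀ r ∈ s, ∀ x ∈ r, ∀ V ∈ C, F x ∈ V →
    ∀ p ∈ V, p.1.1 ∈ U j ∧ p.1.2 ∈ U j}
  have hJne : ∀ s ∈ Nv A.R, (J s).Nonempty := by
    intro s hs'
    obtain ⟨x, hx⟩ := hs'.2.2
    obtain ⟨_, ⟨j, rfl⟩, hj⟩ := hs1 (F x)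
    refine ⟨j, fun r hr x' hx' V hV hFV p hp => ?_⟩
    obtain ⟨_, ⟨Vr, hVr, rfl⟩, hrV⟩ := hAr r (hs'.2.1 r hr)
    obtain ⟨W, hW, hWV⟩ := hs (F x')
    have h1 : F x ∈ W := hWV Vr hVr (hrV hx') (hrV (hx r hr))
    exact hj W hW h1 (hWV V hV hFV hp)
  have hJsub : ∀ s t : Finset (Set X), t ⊆ s → J s ⊆ J t := fun s t hts j hj r hr =>
    hj r (hts hr)
  have hφJ : ∀ s ∈ Nv A.R, ∀ p ∈ Dl s, ∀ j ∈ J s, (A.φ p).1.1 ∈ U j ∧ (A.φ p).1.2 ∈ U j := by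
    intro s hs' p hp j hj
    obtain ⟨x, hx⟩ := hs'.2.2
    obtain ⟨r, hr⟩ := hs'.1
    obtain ⟨V, hV, h1, h2⟩ := hA.g s hs'
    exact hj r hr x (hx r hr) V hV (h2 ⟨x, hx, rfl⟩) _ (h1 ⟨p, hp, rfl⟩)
  have hae : ∀ s ∈ Nv A.R, CExt n (⋂ j ∈ J s, U j) (⋂ j ∈ J s, U j) := by
    intro s hs'
    rcases hcov.2 (J s) (hJne s hs') with h | h
    · exfalso
      obtain ⟨x, hx⟩ := hs'.2.2
      obtain ⟨r, hr⟩ := hs'.1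
      have : (F x).1.1 ∈ ⋂ j ∈ J s, U j := by
        simp only [mem_iInter]
        intro j hj
        obtain ⟨V, hV, h1⟩ := hC.2 (F x)
        exact (hj r hr x (hx r hr) V hV h1 _ h1).1
      rw [h] at this
      exact this
    · exact ae_ext h
  obtain ⟨θ, hθ⟩ := prism_ext (P := Y) hA.ord (univ ×ˢ {0, 1}) (isClosed_univ.prod (by simp))
    (fun q => if q.2 = 0 then (A.φ q.1).1.1 else (A.φ q.1).1.2) (by
      intro s hs
      have e : (univ ×ˢ {0, 1}) ∩ Pr s = (Dl s ×ˢ {(0 : ℝ)}) ∪ (Dl s ×ˢ {(1 : ℝ)}) := by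
        ext ⟨p, t⟩
        simp only [Pr, mem_inter_iff, mem_prod, mem_univ, true_and, mem_insert_iff,
          mem_singleton_iff, mem_union]
        constructor
        · rintro ⟨h | h, h2, -⟩
          exacts [Or.inl ⟨h2, h⟩, Or.inr ⟨h2, h⟩]
        · rintro (⟨h, rfl⟩ | ⟨h, rfl⟩) <;> simp [h]
      rw [e]
      have hc : ∀ t : ℝ, ContinuousOn (fun q : (Set X → ℝ) × ℝ => A.φ q.1) (Dl s ×ˢ {t}) :=
        fun t => (hA.c _ hs).comp continuousOn_fst fun q hq => hq.1
      refine ContinuousOn.union_of_isClosed ?_ ?_ ((Dl_compact s).isClosed.prod isClosed_singleton)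
        ((Dl_compact s).isClosed.prod isClosed_singleton)
      · refine ((continuous_fst.comp continuous_subtype_val).comp_continuousOn (hc 0)).congr ?_
        rintro ⟨p, t⟩ ⟨-, ht⟩
        simp only [mem_singleton_iff] at ht
        simp [ht]
      · refine ((continuous_snd.comp continuous_subtype_val).comp_continuousOn (hc 1)).congr ?_
        rintro ⟨p, t⟩ ⟨-, ht⟩
        simp only [mem_singleton_iff] at ht
        simp [ht])
    (fun s S => S ⊆ ⋂ j ∈ J s, U j) (by
      intro s hs' φ hG
      refine ⟨_, _, hae s hs', ?_, ?_, fun S hS => hS⟩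
      · rintro _ ⟨⟨p, t⟩, ⟨-, hp⟩, rfl⟩
        simp only [mem_iInter]
        intro j hj
        have := hφJ s hs' p hp.1 j hj
        split_ifs
        exacts [this.1, this.2]
      · intro t hts ht
        exact (hG t hts ht).trans (biInter_subset_biInter_left (hJsub s t hts.subset)))
  have hx : ∀ x, ∃ j, ∃ s ∈ Nv A.R, A.κ x ∈ Dl s ∧ j ∈ J s ∧ x ∈ Qs s := by
    intro x
    obtain ⟨s, h1, h2⟩ := hA.pu.mem x
    obtain ⟨h3, h4⟩ := nv_of h1 h2
    obtain ⟨j, hj⟩ := hJne s h3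
    exact ⟨j, s, h3, h2, hj, h4⟩
  choose j s hsN hsD hsJ hsQ using hx
  have hVj : ∀ x, ∀ V ∈ C, F x ∈ V → ∀ p ∈ V, p.1.1 ∈ U (j x) ∧ p.1.2 ∈ U (j x) := by
    intro x
    obtain ⟨r, hr⟩ := (hsN x).1
    exact hsJ x r hr x (hsQ x r hr)
  obtain ⟨h, hc, h0, h1, hm⟩ := hT
  have hmem : ∀ t x, (h (t, x)).1.1 ∈ U (j x) ∧ (h (t, x)).1.2 ∈ U (j x) := by
    intro t x
    obtain ⟨V, hV, e1, e2⟩ := hm t x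
    exact hVj x V hV e2 _ e1
  have H1 : HtQ (fun x => U (j x)) (fun x => (F x).1.1) (fun x => (A.φ (A.κ x)).1.1) :=
    ⟨fun q => (h q).1.1, by fun_prop, fun t x ht => by simp only [h0 t x ht],
      fun t x ht => by simp only [h1 t x ht], fun t x => (hmem t x).1⟩
  have H3 : HtQ (fun x => U (j x)) (fun x => (F x).1.2) (fun x => (A.φ (A.κ x)).1.2) :=
    ⟨fun q => (h q).1.2, by fun_prop, fun t x ht => by simp only [h0 t x ht],
      fun t x ht => by simp only [h1 t x ht], fun t x => (hmem t x).2⟩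
  refine ⟨j, (H1.trans ?_).trans H3.symm⟩
  have hl := pu_pre hA.pu (Prod.snd : ℝ × X → X) continuous_snd
  refine ⟨_, pu_comp hl θ (fun s hs => (hθ s hs).1) (fun q => clp q.1)
    (clp_cont.comp continuous_fst) (fun q => clp_mem _), ?_, ?_, ?_⟩
  · intro t x ht
    have := (hθ _ (hsN x)).2.1 (x := (A.κ x, 0)) ⟨by simp, hsD x, by simp⟩
    simpa [clp_le ht] using this
  · intro t x ht
    have := (hθ _ (hsN x)).2.1 (x := (A.κ x, 1)) ⟨by simp, hsD x, by simp⟩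
    simpa [clp_ge ht] using this
  · intro t x
    have h4 := (hθ _ (hsN x)).2.2 ⟨(A.κ x, clp t), ⟨hsD x, clp_mem t⟩, rfl⟩
    simp only [mem_iInter] at h4
    exact h4 _ (hsJ x)

/-- If `𝒰` is an open `AE(n)`-cover of a metric space `Y`, then any two
`𝒰`-close continuous maps from a metric space of dimension `< n` into `Y` are
`𝒰`-homotopic. -/
theorem statement7 {ι Y : Type*} [MetricSpace Y] (n : ℕ)
    (U : ι → Set Y) (hopen : ∀ i, IsOpen (U i)) (hcov : IsAECover.{u} n U)
    {X : Type*} [MetricSpace X] (hdim : CovDimLT X n)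
    (f g : C(X, Y)) (hclose : CoverClose U f g) :
    CoverHomotopic U f g := by
  rcases isEmpty_or_nonempty X with hX | hX
  · exact ⟨⟨⟨fun q => hX.elim q.2, continuous_iff_continuousAt.2 fun q => hX.elim q.2⟩,
      fun x => hX.elim x, fun x => hX.elim x⟩, fun x => hX.elim x⟩
  · obtain ⟨j, h, hc, h0, h1, hm⟩ := main_aux hopen hcov hdim
      (fun x => (⟨(f x, g x), hclose x⟩ : Pai U))
      ((f.continuous.prodMk g.continuous).subtype_mk _)
    refine ⟨⟨⟨fun q => h (q.1, q.2), by fun_prop⟩, fun x => h0 _ x (by simp),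
      fun x => h1 _ x (by simp)⟩, fun x => ⟨j x, fun t => hm _ x⟩⟩
end
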